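/- arXiv:2306.09016 — 2 statements merged into one kernel-verified Lean document; each statement's English description precedes it below -/
import Mathlib

section
/- Let H be a graph. If the class 𝓕_H of H-expansions has the edge-Erdős–Pósa property, then for every connected component C of H the class 𝓕_C also has the edge-Erdős–Pósa property. -/
open SimpleGraph

/-- `B` is a minor model (family of branch sets) of `H` in `G`. -/
def IsModel {V W : Type} (H : SimpleGraph V) (G : SimpleGraph W)
    (B : V → Set W) : Prop :=
  (∀ v, (B v).Nonempty) ∧
  (∀ v, (G.induce (B v)).Connected) ∧
  (Pairwise fun u v => Disjoint (B u) (B v)) ∧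
  (∀ u v, H.Adj u v → ∃ a ∈ B u, ∃ b ∈ B v, G.Adj a b)

/-- `H` is a minor of `G`. -/
def IsMinor {V W : Type} (H : SimpleGraph V) (G : SimpleGraph W) : Prop :=
  ∃ B : V → Set W, IsModel H G B

/-- `G` contains `k` pairwise edge-disjoint `H`-expansions (subgraphs containing `H`
as a minor). -/
def EdgeDisjointExpansions {VH : Type} (H : SimpleGraph VH) {V : Type}
    (G : SimpleGraph V) (k : ℕ) : Prop :=
  ∃ M : Fin k → G.Subgraph,
    (Pairwise fun i j => Disjoint (M i).edgeSet (M j).edgeSet) ∧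
    ∀ i, IsMinor H (M i).coe

/-- The class of `H`-expansions has the edge-Erdős–Pósa property: there is `f : ℕ → ℝ`
such that every (finite) graph `G` either contains `k` edge-disjoint `H`-expansions or
an edge set `X` with `|X| ≤ f k` meeting every `H`-expansion in `G` (equivalently,
`G - X` has no `H`-minor). -/
def EdgeEP {VH : Type} (H : SimpleGraph VH) : Prop :=
  ∃ f : ℕ → ℝ, ∀ (V : Type) (_ : Fintype V) (G : SimpleGraph V) (k : ℕ),
    EdgeDisjointExpansions H G k ∨
    ∃ X : Set (Sym2 V), X ⊆ G.edgeSet ∧ (X.ncard : ℝ) ≤ f k ∧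
      ¬ IsMinor H (G.deleteEdges X)

/-- connected vertex set, via closed predicates -/
def CS {W : Type} (G : SimpleGraph W) (S : Set W) : Prop :=
  S.Nonempty ∧ ∀ P : W → Prop, (∀ x ∈ S, ∀ y ∈ S, G.Adj x y → P x → P y) →
    ∀ x ∈ S, P x → ∀ y ∈ S, P y

theorem cs_iff {W : Type} (G : SimpleGraph W) (S : Set W) :
    (G.induce S).Connected ↔ CS G S := by
  constructor
  · intro h
    refine ⟨?_, ?_⟩
    · obtain ⟨x⟩ := h.nonempty
      exact ⟨x.1, x.2⟩
    · intro P hP x hx hPx y hy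
      obtain ⟨p⟩ := h.preconnected ⟨x, hx⟩ ⟨y, hy⟩
      have key : ∀ (a b : S) (_ : (G.induce S).Walk a b), P a.1 → P b.1 := by
        intro a b p
        induction p with
        | nil => exact id
        | cons hadj _ ih =>
          intro ha
          exact ih (hP _ (Subtype.prop _) _ (Subtype.prop _) hadj ha)
      exact key _ _ p hPx
  · rintro ⟨⟨x, hx⟩, h⟩
    have : Nonempty S := ⟨⟨x, hx⟩⟩
    refine ⟨?_⟩
    rintro ⟨a, ha⟩ ⟨b, hb⟩
    refine h (fun y => ∀ hy : y ∈ S, (G.induce S).Reachable ⟨a, ha⟩ ⟨y, hy⟩) ?_ a ha ?_ b hb hb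
    · intro u hu v hv huv hr _
      exact (hr hu).trans (Adj.reachable (by simpa using huv))
    · intro _
      exact Reachable.refl _

/-- model of `H[s]` in `G[T]` -/
def Md {V W : Type} (H : SimpleGraph V) (s : Set V) (G : SimpleGraph W) (T : Set W)
    (B : V → Set W) : Prop :=
  (∀ v ∈ s, B v ⊆ T) ∧ (∀ v ∈ s, CS G (B v)) ∧
  (∀ u ∈ s, ∀ v ∈ s, u ≠ v → Disjoint (B u) (B v)) ∧
  (∀ u ∈ s, ∀ v ∈ s, H.Adj u v → ∃ a ∈ B u, ∃ b ∈ B v, G.Adj a b)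

def Mn {V W : Type} (H : SimpleGraph V) (s : Set V) (G : SimpleGraph W) (T : Set W) : Prop :=
  ∃ B, Md H s G T B

theorem isMinor_iff {V W : Type} (H : SimpleGraph V) (G : SimpleGraph W) :
    IsMinor H G ↔ Mn H Set.univ G Set.univ := by
  constructor
  · rintro ⟨B, h1, h2, h3, h4⟩
    exact ⟨B, fun _ _ => Set.subset_univ _, fun v _ => (cs_iff _ _).1 (h2 v),
      fun u _ v _ huv => h3 huv, fun u _ v _ => h4 u v⟩
  · rintro ⟨B, h1, h2, h3, h4⟩
    exact ⟨B, fun v => (h2 v trivial).1, fun v => (cs_iff _ _).2 (h2 v trivial),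
      fun u v huv => h3 u trivial v trivial huv, fun u v => h4 u trivial v trivial⟩

theorem isMinor_induce {V W : Type} (H : SimpleGraph V) (s : Set V) (G : SimpleGraph W) :
    IsMinor (H.induce s) G ↔ Mn H s G Set.univ := by
  constructor
  · rintro ⟨B, h1, h2, h3, h4⟩
    have hB : ∀ v (h : v ∈ s), {w | ∃ h : v ∈ s, w ∈ B ⟨v, h⟩} = B ⟨v, h⟩ := by
      intro v h
      ext w
      simp [h]
    refine ⟨fun v => {w | ∃ h : v ∈ s, w ∈ B ⟨v, h⟩}, fun _ _ => Set.subset_univ _, ?_, ?_, ?_⟩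
    · intro v hv
      simp only [hB v hv]
      exact (cs_iff _ _).1 (h2 _)
    · intro u hu v hv huv
      simp only [hB v hv, hB u hu]
      exact h3 (by simpa using huv)
    · intro u hu v hv huv
      simp only [hB v hv, hB u hu]
      exact h4 ⟨u, hu⟩ ⟨v, hv⟩ (by simpa using huv)
  · rintro ⟨B, h1, h2, h3, h4⟩
    exact ⟨fun v => B v.1, fun v => (h2 v.1 v.2).1, fun v => (cs_iff _ _).2 (h2 v.1 v.2),
      fun u v huv => h3 u.1 u.2 v.1 v.2 (fun h => huv (Subtype.ext h)),
      fun u v huv => h4 u.1 u.2 v.1 v.2 huv⟩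

theorem Mn.weaken {V W : Type} {H : SimpleGraph V} {s : Set V} {G : SimpleGraph W}
    {T T' : Set W} (h : Mn H s G T) (hT : T ⊆ T') : Mn H s G T' := by
  obtain ⟨B, h1, h2⟩ := h
  exact ⟨B, fun v hv => (h1 v hv).trans hT, h2⟩

theorem Mn.push {V W W' : Type} {H : SimpleGraph V} {s : Set V} {G : SimpleGraph W}
    {T : Set W} (h : Mn H s G T) {K : SimpleGraph W'} (f : W → W') (hf : Set.InjOn f T)
    (hh : ∀ a ∈ T, ∀ b ∈ T, G.Adj a b → K.Adj (f a) (f b)) : Mn H s K (f '' T) := by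
  obtain ⟨B, h1, h2, h3, h4⟩ := h
  refine ⟨fun v => f '' B v, fun v hv => Set.image_mono (h1 v hv), ?_, ?_, ?_⟩
  · intro v hv
    refine ⟨(h2 v hv).1.image f, ?_⟩
    rintro P hP _ ⟨x, hx, rfl⟩ hPx _ ⟨y, hy, rfl⟩
    refine (h2 v hv).2 (fun z => P (f z)) ?_ x hx hPx y hy
    intro a ha b hb hab
    exact hP _ ⟨a, ha, rfl⟩ _ ⟨b, hb, rfl⟩ (hh a (h1 v hv ha) b (h1 v hv hb) hab)
  · intro u hu v hv huv
    rw [Set.disjoint_left]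
    rintro _ ⟨x, hx, rfl⟩ ⟨y, hy, hxy⟩
    have := hf (h1 v hv hy) (h1 u hu hx) hxy
    subst this
    exact Set.disjoint_left.1 (h3 u hu v hv huv) hx hy
  · intro u hu v hv huv
    obtain ⟨a, ha, b, hb, hab⟩ := h4 u hu v hv huv
    exact ⟨f a, ⟨a, ha, rfl⟩, f b, ⟨b, hb, rfl⟩, hh a (h1 u hu ha) b (h1 v hv hb) hab⟩

theorem Mn.pull {V W W' : Type} {H : SimpleGraph V} {s : Set V} {K : SimpleGraph W'}
    (f : W → W') (hf : Function.Injective f) (h : Mn H s K (Set.range f)) :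
    Mn H s (K.comap f) Set.univ := by
  obtain ⟨B, h1, h2, h3, h4⟩ := h
  refine ⟨fun v => f ⁻¹' B v, fun v hv => Set.subset_univ _, ?_, ?_, ?_⟩
  · intro v hv
    refine ⟨?_, ?_⟩
    · obtain ⟨y, hy⟩ := (h2 v hv).1
      obtain ⟨x, rfl⟩ := h1 v hv hy
      exact ⟨x, hy⟩
    · intro P hP x hx hPx y hy
      obtain ⟨y', hy', hPy⟩ := (h2 v hv).2 (fun z => ∃ x, f x = z ∧ P x) (by
        rintro _ ha b hb hab ⟨a, rfl, hPa⟩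
        obtain ⟨b, rfl⟩ := h1 v hv hb
        exact ⟨b, rfl, hP a ha b hb hab hPa⟩) (f x) hx ⟨x, rfl, hPx⟩ (f y) hy
      rw [← hf hy']
      exact hPy
  · intro u hu v hv huv
    exact (h3 u hu v hv huv).preimage f
  · intro u hu v hv huv
    obtain ⟨a, ha, b, hb, hab⟩ := h4 u hu v hv huv
    obtain ⟨x, rfl⟩ := h1 u hu ha
    obtain ⟨y, rfl⟩ := h1 v hv hb
    exact ⟨x, ha, y, hb, hab⟩

theorem Mn.trans {V W Z : Type} {H : SimpleGraph V} {s : Set V} {G : SimpleGraph W}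
    {T : Set W} {K : SimpleGraph Z} {U : Set Z} (h : Mn H s G T) (h' : Mn G T K U) :
    Mn H s K U := by
  obtain ⟨B, h1, h2, h3, h4⟩ := h
  obtain ⟨B', g1, g2, g3, g4⟩ := h'
  refine ⟨fun v => {z | ∃ x ∈ B v, z ∈ B' x}, ?_, ?_, ?_, ?_⟩
  · rintro v hv z ⟨x, hx, hz⟩
    exact g1 x (h1 v hv hx) hz
  · intro v hv
    refine ⟨?_, ?_⟩
    · obtain ⟨x, hx⟩ := (h2 v hv).1
      obtain ⟨z, hz⟩ := (g2 x (h1 v hv hx)).1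
      exact ⟨z, x, hx, hz⟩
    · rintro P hP a ⟨x, hx, ha⟩ hPa b ⟨y, hy, hb⟩
      have all : ∀ w ∈ B v, ∀ a ∈ B' w, P a → ∀ b ∈ B' w, P b := by
        intro w hw
        apply (g2 w (h1 v hv hw)).2 P
        intro p hp q hq
        exact hP p ⟨w, hw, hp⟩ q ⟨w, hw, hq⟩
      refine (h2 v hv).2 (fun w => ∀ b ∈ B' w, P b) ?_ x hx (all x hx a ha hPa) y hy b hb
      intro p hp q hq hpq hPp
      obtain ⟨c, hc, d, hd, hcd⟩ := g4 p (h1 v hv hp) q (h1 v hv hq) hpq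
      exact all q hq d hd (hP c ⟨p, hp, hc⟩ d ⟨q, hq, hd⟩ hcd (hPp c hc))
  · intro u hu v hv huv
    rw [Set.disjoint_left]
    rintro z ⟨x, hx, hz⟩ ⟨y, hy, hz'⟩
    by_cases hxy : x = y
    · subst hxy
      exact Set.disjoint_left.1 (h3 u hu v hv huv) hx hy
    · exact Set.disjoint_left.1 (g3 x (h1 u hu hx) y (h1 v hv hy) hxy) hz hz'
  · intro u hu v hv huv
    obtain ⟨a, ha, b, hb, hab⟩ := h4 u hu v hv huv
    obtain ⟨c, hc, d, hd, hcd⟩ := g4 a (h1 u hu ha) b (h1 v hv hb) hab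
    exact ⟨c, ⟨a, ha, hc⟩, d, ⟨b, hb, hd⟩, hcd⟩

theorem Mn.union {V W : Type} {H : SimpleGraph V} {s s' : Set V} {G : SimpleGraph W}
    {T T' : Set W} (h : Mn H s G T) (h' : Mn H s' G T') (hT : Disjoint T T')
    (hs : ∀ u ∈ s, ∀ v ∈ s', u ≠ v ∧ ¬ H.Adj u v) : Mn H (s ∪ s') G (T ∪ T') := by
  classical
  obtain ⟨B, h1, h2, h3, h4⟩ := h
  obtain ⟨B', g1, g2, g3, g4⟩ := h'
  have e1 : ∀ v ∈ s, (if v ∈ s then B v else B' v) = B v := fun v hv => if_pos hv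
  have e2 : ∀ v ∈ s', (if v ∈ s then B v else B' v) = B' v :=
    fun v hv => if_neg (fun h => (hs v h v hv).1 rfl)
  refine ⟨fun v => if v ∈ s then B v else B' v, ?_, ?_, ?_, ?_⟩
  · rintro v (hv | hv)
    · simp only [e1 v hv]
      exact (h1 v hv).trans Set.subset_union_left
    · simp only [e2 v hv]
      exact (g1 v hv).trans Set.subset_union_right
  · rintro v (hv | hv)
    · simp only [e1 v hv]
      exact h2 v hv
    · simp only [e2 v hv]
      exact g2 v hv
  · rintro u (hu | hu) v (hv | hv) huv
    · simp only [e1 v hv, e1 u hu]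
      exact h3 u hu v hv huv
    · simp only [e2 v hv, e1 u hu]
      exact hT.mono (h1 u hu) (g1 v hv)
    · simp only [e1 v hv, e2 u hu]
      exact (hT.mono (h1 v hv) (g1 u hu)).symm
    · simp only [e2 v hv, e2 u hu]
      exact g3 u hu v hv huv
  · rintro u (hu | hu) v (hv | hv) huv
    · simp only [e1 v hv, e1 u hu]
      exact h4 u hu v hv huv
    · exact absurd huv (hs u hu v hv).2
    · exact absurd huv.symm (hs v hv u hu).2
    · simp only [e2 v hv, e2 u hu]
      exact g4 u hu v hv huv

/-- packings by spanning subgraphs -/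
def Pk {V W : Type} (H : SimpleGraph V) (s : Set V) (G : SimpleGraph W) (k : ℕ) : Prop :=
  ∃ M : Fin k → SimpleGraph W, (∀ i, M i ≤ G) ∧
    (∀ i j, i ≠ j → ∀ a b, (M i).Adj a b → ¬ (M j).Adj a b) ∧ ∀ i, Mn H s (M i) Set.univ

theorem pk_of_finset {V W ι : Type} {H : SimpleGraph V} {s : Set V} {G : SimpleGraph W} {k : ℕ}
    (I : Finset ι) (hk : k ≤ I.card) (M : ι → SimpleGraph W) (h1 : ∀ i ∈ I, M i ≤ G)
    (h2 : ∀ i j, i ≠ j → ∀ a b, (M i).Adj a b → ¬ (M j).Adj a b)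
    (h3 : ∀ i ∈ I, Mn H s (M i) Set.univ) : Pk H s G k := by
  let e : Fin k ↪ I := (Fin.castLEEmb hk).trans I.equivFin.symm.toEmbedding
  refine ⟨fun i => M (e i).1, fun i => h1 _ (e i).2, ?_, fun i => h3 _ (e i).2⟩
  intro i j hij
  apply h2
  intro h
  exact hij (e.injective (Subtype.ext h))

theorem pk_of_ede {V W : Type} {H : SimpleGraph V} {G : SimpleGraph W} {k : ℕ}
    (h : EdgeDisjointExpansions H G k) : Pk H Set.univ G k := by
  obtain ⟨M, h1, h2⟩ := h
  refine ⟨fun i => (M i).spanningCoe, fun i => (M i).spanningCoe_le, ?_, ?_⟩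
  · intro i j hij a b hab hab'
    have : Disjoint (M i).edgeSet (M j).edgeSet := h1 hij
    rw [Set.disjoint_left] at this
    exact @this s(a, b) (by simpa using hab) (by simpa using hab')
  · intro i
    have := (isMinor_iff _ _).1 (h2 i)
    refine (this.push (K := (M i).spanningCoe) Subtype.val
      (Subtype.val_injective.injOn) ?_).weaken (Set.subset_univ _)
    intro a _ b _ hab
    simpa using hab

theorem ede_of_pk {V W : Type} {H : SimpleGraph V} {s : Set V} {G : SimpleGraph W} {k : ℕ}
    (h : Pk H s G k) : EdgeDisjointExpansions (H.induce s) G k := by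
  obtain ⟨M, h0, h1, h2⟩ := h
  refine ⟨fun i => SimpleGraph.toSubgraph (M i) (h0 i), ?_, ?_⟩
  · intro i j hij
    rw [Set.disjoint_left]
    intro e
    induction e with
    | _ a b =>
      intro ha hb
      exact h1 i j hij a b (by simpa using ha) (by simpa using hb)
  · intro i
    rw [isMinor_induce]
    refine ((h2 i).push (K := (SimpleGraph.toSubgraph (M i) (h0 i)).coe)
      (fun w => ⟨w, trivial⟩) ?_ ?_).weaken (Set.subset_univ _)
    · intro a _ b _ hab
      exact congrArg Subtype.val hab
    · intro a _ b _ hab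
      simpa using hab

theorem exists_avoid {W : Type} [Finite W] {N : ℕ} (M : Fin N → SimpleGraph W)
    (h : ∀ i j, i ≠ j → ∀ a b, (M i).Adj a b → ¬ (M j).Adj a b) (X : Set (Sym2 W))
    (hX : X.ncard < N) : ∃ i, ∀ a b, (M i).Adj a b → s(a, b) ∉ X := by
  by_contra hc
  push Not at hc
  choose a b hab hm using hc
  have inj : Function.Injective (fun i => (⟨s(a i, b i), hm i⟩ : X)) := by
    intro i j hij
    by_contra hne
    have h1 : s(a i, b i) = s(a j, b j) := congrArg Subtype.val hij
    have h2 : (M j).Adj (a i) (b i) := by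
      rw [← SimpleGraph.mem_edgeSet, h1]
      exact hab j
    exact h i j hne _ _ (hab i) h2
  have := Nat.card_le_card_of_injective _ inj
  rw [Nat.card_coe_set_eq] at this
  simp at this
  omega

/-- graphs with a vertex cover of size at most `t` packing `N` copies, for all `N`. -/
def Claim {V : Type} (H : SimpleGraph V) (r : Set V) (t : ℕ) : Prop :=
  ∀ N : ℕ, ∃ (W : Type) (_ : Fintype W) (A : SimpleGraph W) (U : Finset W), U.card ≤ t ∧
    (∀ a b, A.Adj a b → a ∈ U ∨ b ∈ U) ∧ Pk H r A N

theorem claim_init {V : Type} [Fintype V] (H : SimpleGraph V) (r : Set V) :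
    Claim H r (Fintype.card V) := by
  classical
  intro N
  let Q : Fin N → SimpleGraph (V ⊕ (V × V × Fin N)) := fun i =>
    SimpleGraph.fromRel (fun a b => ∃ x u v, a = Sum.inl x ∧ b = Sum.inr (u, v, i))
  have hQ : ∀ i x u v, (Q i).Adj (Sum.inl x) (Sum.inr (u, v, i)) := by
    intro i x u v
    simp [Q]
  refine ⟨V ⊕ (V × V × Fin N), inferInstance, ⨆ i, Q i, Finset.univ.map Function.Embedding.inl,
    by simp, ?_, Q, fun i => le_iSup Q i, ?_, ?_⟩
  · intro a b hab
    simp only [SimpleGraph.iSup_adj, Q, SimpleGraph.fromRel_adj] at hab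
    obtain ⟨i, _, ⟨x, u, v, rfl, rfl⟩ | ⟨x, u, v, rfl, rfl⟩⟩ := hab <;> simp
  · intro i j hij a b h1 h2
    simp only [Q, SimpleGraph.fromRel_adj] at h1 h2
    obtain ⟨_, ⟨x, u, v, rfl, rfl⟩ | ⟨x, u, v, rfl, rfl⟩⟩ := h1 <;> simp at h2 <;>
      exact hij h2
  · intro i
    refine ⟨fun u => {z | z = Sum.inl u ∨ ∃ v, z = Sum.inr (u, v, i)}, fun _ _ => Set.subset_univ _,
      ?_, ?_, ?_⟩
    · intro u _
      refine ⟨⟨Sum.inl u, Or.inl rfl⟩, ?_⟩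
      intro P hP x hx hPx y hy
      have hc : P (Sum.inl u) := by
        rcases hx with rfl | ⟨v, rfl⟩
        · exact hPx
        · exact hP _ (Or.inr ⟨v, rfl⟩) _ (Or.inl rfl) (hQ i u u v).symm hPx
      rcases hy with rfl | ⟨v, rfl⟩
      · exact hc
      · exact hP _ (Or.inl rfl) _ (Or.inr ⟨v, rfl⟩) (hQ i u u v) hc
    · intro u _ v _ huv
      rw [Set.disjoint_left]
      rintro z (rfl | ⟨w, rfl⟩) (h | ⟨w', h⟩) <;> simp at h <;> tauto
    · intro u _ v _ _
      exact ⟨Sum.inr (u, v, i), Or.inr ⟨v, rfl⟩, Sum.inl v, Or.inl rfl, (hQ i v u v).symm⟩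

theorem hub_step {V : Type} (H : SimpleGraph V) (r s : Set V) (hrs : Disjoint r s)
    (hs : ∃ u ∈ s, ∃ v ∈ s, H.Adj u v) (t : ℕ) (ht : Claim H r t) :
    ∃ k' : ℕ, ∀ N : ℕ, ∃ (W : Type) (_ : Fintype W) (A : SimpleGraph W),
      Pk H r A N ∧ ¬ Pk H (r ∪ s) A k' := by
  classical
  obtain ⟨u0, hu0, v0, hv0, huv0⟩ := hs
  induction t with
  | zero =>
    refine ⟨1, fun N => ?_⟩
    obtain ⟨W, i, A, U, hU, hc, hp⟩ := ht N
    refine ⟨W, i, A, hp, ?_⟩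
    rintro ⟨M, m1, m2, m3⟩
    obtain ⟨B, h1, h2, h3, h4⟩ := m3 0
    obtain ⟨a, ha, b, hb, hab⟩ := h4 u0 (Or.inr hu0) v0 (Or.inr hv0) huv0
    have := hc a b (m1 0 hab)
    have : U = ∅ := by simpa using hU
    subst this
    simp_all
  | succ t ih =>
    by_cases hc : Claim H r t
    · exact ih hc
    · unfold Claim at hc
      push Not at hc
      obtain ⟨N0, hN0⟩ := hc
      refine ⟨(t + 1) * N0 + 1, fun N => ?_⟩
      obtain ⟨W, i, A, U, hU, hc, hp⟩ := ht N
      refine ⟨W, i, A, hp, ?_⟩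
      rintro ⟨M, m1, m2, m3⟩
      choose B hB using m3
      have hx : ∀ i, ∃ x ∈ U, ∃ w ∈ s, x ∈ B i w := by
        intro i
        obtain ⟨h1, h2, h3, h4⟩ := hB i
        obtain ⟨a, ha, b, hb, hab⟩ := h4 u0 (Or.inr hu0) v0 (Or.inr hv0) huv0
        rcases hc a b (m1 i hab) with h | h
        · exact ⟨a, h, u0, hu0, ha⟩
        · exact ⟨b, h, v0, hv0, hb⟩
      choose x hxU w hws hxw using hx
      obtain ⟨y, hy, hcard⟩ := Finset.exists_lt_card_fiber_of_mul_lt_card_of_maps_to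
        (s := (Finset.univ : Finset (Fin ((t + 1) * N0 + 1)))) (t := U) (f := x) (n := N0)
        (fun i _ => hxU i) (by
          simp only [Finset.card_univ, Fintype.card_fin]
          have := Nat.mul_le_mul_right N0 hU
          omega)
      let D : SimpleGraph W → SimpleGraph W := fun G =>
        { Adj := fun a b => G.Adj a b ∧ a ≠ y ∧ b ≠ y
          symm := ⟨fun a b h => ⟨h.1.symm, h.2.2, h.2.1⟩⟩
          loopless := ⟨fun a h => G.loopless.irrefl a h.1⟩ }
      refine hN0 W i (D A) (U.erase y) ?_ ?_ ?_
      · rw [Finset.card_erase_of_mem hy]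
        omega
      · rintro a b ⟨hab, ha, hb⟩
        rcases hc a b hab with h | h
        · exact Or.inl (by simp [ha, h])
        · exact Or.inr (by simp [hb, h])
      · refine pk_of_finset _ hcard.le (fun i => D (M i)) ?_ ?_ ?_
        · intro i _ a b hab
          exact ⟨m1 i hab.1, hab.2⟩
        · intro i j hij a b h h'
          exact m2 i j hij a b h.1 h'.1
        · intro i hi
          simp only [Finset.mem_filter, Finset.mem_univ, true_and] at hi
          obtain ⟨h1, h2, h3, h4⟩ := hB i
          have hny : ∀ v ∈ r, ∀ a ∈ B i v, a ≠ y := by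
            rintro v hv a ha rfl
            have hne : v ≠ w i := by
              rintro rfl
              exact Set.disjoint_left.1 hrs hv (hws i)
            refine Set.disjoint_left.1 (h3 v (Or.inl hv) (w i) (Or.inr (hws i)) hne) ha ?_
            rw [← hi]
            exact hxw i
          refine ⟨B i, fun _ _ => Set.subset_univ _, ?_, ?_, ?_⟩
          · intro v hv
            refine ⟨(h2 v (Or.inl hv)).1, ?_⟩
            intro P hP
            apply (h2 v (Or.inl hv)).2 P
            intro p hp q hq hpq
            exact hP p hp q hq ⟨hpq, hny v hv p hp, hny v hv q hq⟩
          · intro u hu v hv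
            exact h3 u (Or.inl hu) v (Or.inl hv)
          · intro u hu v hv huv
            obtain ⟨a, ha, b, hb, hab⟩ := h4 u (Or.inl hu) v (Or.inl hv) huv
            exact ⟨a, ha, b, hb, hab, hny u hu a ha, hny v hv b hb⟩

theorem color_const {V W ι : Type} {H : SimpleGraph V} {s : Set V} (hs : CS H s)
    {K : SimpleGraph W} {B : V → Set W} (hB : Md H s K Set.univ B) (κ : W → ι)
    (hκ : ∀ a b, K.Adj a b → κ a = κ b) : ∃ i, ∀ v ∈ s, B v ⊆ κ ⁻¹' {i} := by
  obtain ⟨h1, h2, h3, h4⟩ := hB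
  obtain ⟨v0, hv0⟩ := hs.1
  obtain ⟨a0, ha0⟩ := (h2 v0 hv0).1
  have all : ∀ v ∈ s, ∀ a ∈ B v, κ a = κ a0 → ∀ b ∈ B v, κ b = κ a0 := by
    intro v hv
    apply (h2 v hv).2 (fun a => κ a = κ a0)
    intro x _ y _ hxy hx
    rw [← hκ x y hxy, hx]
  refine ⟨κ a0, fun v hv b hb => ?_⟩
  refine hs.2 (fun v => ∀ b ∈ B v, κ b = κ a0) ?_ v0 hv0 (all v0 hv0 a0 ha0 rfl) v hv b hb
  intro x hx y hy hxy hPx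
  obtain ⟨a, ha, b, hb, hab⟩ := h4 x hx y hy hxy
  exact all y hy b hb (by rw [← hκ a b hab]; exact hPx a ha)

theorem cs_supp {V : Type} (H : SimpleGraph V) (d : H.ConnectedComponent) : CS H d.supp :=
  (cs_iff _ _).1 d.connected_toSimpleGraph

theorem Md.restrict {V W : Type} {H : SimpleGraph V} {s s' : Set V} {G : SimpleGraph W}
    {T T' : Set W} {B : V → Set W} (h : Md H s G T B) (hs : s' ⊆ s)
    (hT : ∀ v ∈ s', B v ⊆ T') : Mn H s' G T' := by
  obtain ⟨h1, h2, h3, h4⟩ := h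
  exact ⟨B, hT, fun v hv => h2 v (hs hv), fun u hu v hv => h3 u (hs hu) v (hs hv),
    fun u hu v hv => h4 u (hs hu) v (hs hv)⟩

theorem edgeEP_trivial {V : Type} (H : SimpleGraph V) (s : Set V) (hs : CS H s)
    (hn : ¬ ∃ u ∈ s, ∃ v ∈ s, H.Adj u v) : EdgeEP (H.induce s) := by
  refine ⟨fun _ => 0, fun W _ G k => ?_⟩
  have hsub : ∀ x ∈ s, ∀ y ∈ s, y = x := by
    intro x hx y hy
    refine hs.2 (fun z => z = x) ?_ x hx rfl y hy
    intro a ha b hb hab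
    exact absurd ⟨a, ha, b, hb, hab⟩ hn
  rcases isEmpty_or_nonempty W with hW | ⟨⟨w⟩⟩
  · right
    refine ⟨∅, by simp, by simp, ?_⟩
    rw [isMinor_induce]
    rintro ⟨B, h1, h2, -⟩
    obtain ⟨v, hv⟩ := hs.1
    obtain ⟨a, -⟩ := (h2 v hv).1
    exact hW.false a
  · left
    apply ede_of_pk
    refine ⟨fun _ => ⊥, fun _ => bot_le, fun i j _ a b h => by simp at h, fun i => ?_⟩
    refine ⟨fun _ => {w}, fun _ _ => Set.subset_univ _, ?_, ?_, ?_⟩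
    · intro v _
      refine ⟨⟨w, rfl⟩, ?_⟩
      rintro P hP x rfl hx y rfl
      exact hx
    · intro u hu v hv huv
      exact absurd (hsub v hv u hu) huv
    · intro u hu v hv huv
      exact absurd ⟨u, hu, v, hv, huv⟩ hn

/-- the disjoint copies -/
def copies {V : Type} (H : SimpleGraph V) (S : Set V) (N : ℕ) : SimpleGraph (S × Fin N) where
  Adj p q := p.2 = q.2 ∧ H.Adj p.1 q.1
  symm := ⟨fun _ _ h => ⟨h.1.symm, h.2.symm⟩⟩
  loopless := ⟨fun _ h => H.loopless.irrefl _ h.2⟩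

theorem copies_pk {V : Type} (H : SimpleGraph V) (S : Set V) (N : ℕ) : Pk H S (copies H S N) N := by
  let M : Fin N → SimpleGraph (S × Fin N) := fun i =>
    { Adj := fun p q => p.2 = i ∧ q.2 = i ∧ H.Adj p.1 q.1
      symm := ⟨fun _ _ h => ⟨h.2.1, h.1, h.2.2.symm⟩⟩
      loopless := ⟨fun _ h => H.loopless.irrefl _ h.2.2⟩ }
  refine ⟨M, ?_, ?_, ?_⟩
  · intro i p q h
    exact ⟨h.1.trans h.2.1.symm, h.2.2⟩
  · intro i j hij a b h h'
    exact hij (h.1.symm.trans h'.1)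
  · intro i
    refine ⟨fun v => {p | p.1.1 = v ∧ p.2 = i}, fun _ _ => Set.subset_univ _, ?_, ?_, ?_⟩
    · intro v hv
      refine ⟨⟨(⟨v, hv⟩, i), rfl, rfl⟩, ?_⟩
      rintro P hP ⟨⟨x, _⟩, _⟩ ⟨rfl, rfl⟩ hx ⟨⟨y, _⟩, _⟩ ⟨h1, h2⟩
      simp only at h1 h2
      subst h1 h2
      exact hx
    · intro u _ v _ huv
      rw [Set.disjoint_left]
      rintro p ⟨h1, _⟩ ⟨h2, _⟩
      exact huv (h1.symm.trans h2)
    · intro u hu v hv huv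
      exact ⟨(⟨u, hu⟩, i), ⟨rfl, rfl⟩, (⟨v, hv⟩, i), ⟨rfl, rfl⟩, rfl, rfl, huv⟩

/-- A packing survives few edge deletions, inside a bigger graph. -/
theorem Pk.survive {V W W' : Type} [Finite W] {H : SimpleGraph V} {s : Set V} {G : SimpleGraph W}
    {N : ℕ} (h : Pk H s G N) (K : SimpleGraph W') [Finite W'] (f : W → W')
    (hf : Function.Injective f)
    (hK : ∀ a b, G.Adj a b → K.Adj (f a) (f b)) (X : Set (Sym2 W')) (hX : X.ncard < N) :
    Mn H s (K.deleteEdges X) (Set.range f) := by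
  obtain ⟨M, m1, m2, m3⟩ := h
  have hle : (Sym2.map f ⁻¹' X).ncard ≤ X.ncard :=
    Set.ncard_le_ncard_of_injOn (Sym2.map f) (fun a ha => ha)
      (Sym2.map.injective hf).injOn (Set.toFinite X)
  obtain ⟨i, hi⟩ := exists_avoid M m2 (Sym2.map f ⁻¹' X) (hle.trans_lt hX)
  refine ((m3 i).push f hf.injOn ?_).weaken (Set.image_subset_range _ _)
  intro a _ b _ hab
  rw [SimpleGraph.deleteEdges_adj]
  exact ⟨hK a b (m1 i hab), fun h => hi a b hab (by simpa using h)⟩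

/-- If `𝓕_H` has the edge-Erdős–Pósa property, then so does `𝓕_C`
for every connected component `C` of `H`. -/
theorem edgeEP_of_component {VH : Type} [Fintype VH] (H : SimpleGraph VH)
    (hH : EdgeEP H) (c : H.ConnectedComponent) :
    EdgeEP (H.induce c.supp) := by
  classical
  by_cases hn : ∃ u ∈ c.supp, ∃ v ∈ c.supp, H.Adj u v
  swap
  · exact edgeEP_trivial H _ (cs_supp H c) hn
  obtain ⟨f, hf⟩ := hH
  let big : H.ConnectedComponent → Prop := fun d => Mn H c.supp H d.supp
  have hcbig : big c := by
    refine ⟨fun v => {v}, ?_, ?_, ?_, ?_⟩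
    · intro v hv
      simpa using hv
    · intro v _
      refine ⟨⟨v, rfl⟩, ?_⟩
      rintro P hP x rfl hx y rfl
      exact hx
    · intro u _ v _ huv
      simpa using huv
    · intro u _ v _ huv
      exact ⟨u, rfl, v, rfl, huv⟩
  let R : Set VH := {v | H.connectedComponentMk v ≠ c ∧ big (H.connectedComponentMk v)}
  let S : Set VH := {v | ¬ big (H.connectedComponentMk v)}
  have hRc : Disjoint R c.supp := by
    rw [Set.disjoint_left]
    intro v hv hv'
    exact hv.1 hv'
  obtain ⟨k', hk'⟩ := hub_step H R c.supp hRc hn _ (claim_init H R)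
  refine ⟨fun k => f (k + k'), fun V _ G k => ?_⟩
  set N : ℕ := ⌊f (k + k')⌋₊ + 1 with hN
  obtain ⟨W, _, A, hA, hA'⟩ := hk' N
  let G' : SimpleGraph (V ⊕ (W ⊕ (S × Fin N))) := G ⊕g (A ⊕g (copies H S N))
  rcases hf _ inferInstance G' (k + k') with h | ⟨X, hXG, hXc, hXm⟩
  · left
    apply ede_of_pk
    obtain ⟨M, m1, m2, m3⟩ := pk_of_ede h
    let κ : V ⊕ (W ⊕ (S × Fin N)) → Unit ⊕ (Unit ⊕ (H.ConnectedComponent × Fin N)) :=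
      Sum.map (fun _ => ()) (Sum.map (fun _ => ())
        (fun p => (H.connectedComponentMk p.1.1, p.2)))
    have hκ : ∀ a b, G'.Adj a b → κ a = κ b := by
      rintro (a | a | a) (b | b | b) hab <;> simp [G', copies] at hab <;> simp [κ]
      exact ⟨hab.2.reachable, hab.1⟩
    have dich : ∀ i, Mn H c.supp (M i) (Set.range Sum.inl) ∨
        Mn H (R ∪ c.supp) (M i) (Set.range (fun w => Sum.inr (Sum.inl w))) := by
      intro i
      obtain ⟨B, hB⟩ := m3 i
      have hcol := fun d : H.ConnectedComponent => color_const (cs_supp H d) (s := d.supp)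
        (B := B) (K := M i) ⟨fun _ _ => Set.subset_univ _, fun v _ => hB.2.1 v trivial,
          fun u _ v _ => hB.2.2.1 u trivial v trivial,
          fun u _ v _ => hB.2.2.2 u trivial v trivial⟩ κ (fun a b hab => hκ a b (m1 i hab))
      choose col hcol using hcol
      by_cases hG : ∃ d, big d ∧ col d = Sum.inl ()
      · left
        obtain ⟨d, hd, hdc⟩ := hG
        refine Mn.trans hd (hB.restrict (Set.subset_univ _) ?_)
        intro v hv z hz
        have := hcol d v hv hz
        rw [hdc] at this
        rcases z with z | z | z
        · exact ⟨z, rfl⟩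
        · simp [κ] at this
        · simp [κ] at this
      · right
        have hbig : ∀ d, big d → col d = Sum.inr (Sum.inl ()) := by
          intro d hd
          rcases hcd : col d with ⟨⟩ | ⟨⟩ | ⟨d', j⟩
          · exact absurd ⟨d, hd, hcd⟩ hG
          · rfl
          · exfalso
            have h1 : Mn H c.supp (M i) (κ ⁻¹' {Sum.inr (Sum.inr (d', j))}) := by
              refine Mn.trans hd (hB.restrict (Set.subset_univ _) ?_)
              rw [← hcd]
              exact hcol d
            obtain ⟨v, hv⟩ := (cs_supp H d).1
            obtain ⟨z, hz⟩ := (hB.2.1 v trivial).1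
            have hz' := hcol d v hv hz
            rw [hcd] at hz'
            have hsmall : ¬ big d' := by
              rcases z with z | z | z
              · simp [κ] at hz'
              · simp [κ] at hz'
              · simp [κ] at hz'
                rw [← hz'.1]
                exact z.1.2
            apply hsmall
            let g : V ⊕ (W ⊕ (S × Fin N)) → VH :=
              Sum.elim (fun _ => v) (Sum.elim (fun _ => v) (fun p => p.1.1))
            refine (h1.push (K := H) g ?_ ?_).weaken ?_
            · rintro (a | a | ⟨⟨a, ha⟩, a'⟩) h (b | b | ⟨⟨b, hb⟩, b'⟩) h' hab <;>
                simp [κ] at h h'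
              simp [g] at hab
              simp [hab, h.2, h'.2]
            · rintro (a | a | ⟨⟨a, ha⟩, a'⟩) h (b | b | ⟨⟨b, hb⟩, b'⟩) h' hab <;>
                simp [κ] at h h'
              have := m1 i hab
              simp [G', copies] at this
              exact this.2
            · rintro _ ⟨(a | a | ⟨⟨a, ha⟩, a'⟩), h, rfl⟩ <;> simp [κ] at h
              exact h.1
        refine hB.restrict (Set.subset_univ _) ?_
        intro v hv z hz
        have hvb : big (H.connectedComponentMk v) := by
          rcases hv with hv | hv
          · exact hv.2
          · have : H.connectedComponentMk v = c := hv
            rw [this]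
            exact hcbig
        have := hcol _ v rfl hz
        rw [hbig _ hvb] at this
        rcases z with z | z | z
        · simp [κ] at this
        · exact ⟨z, rfl⟩
        · simp [κ] at this
    let I : Finset (Fin (k + k')) := Finset.univ.filter
      (fun i => Mn H c.supp (M i) (Set.range Sum.inl))
    have hIc : I.card + Iᶜ.card = k + k' := by
      rw [Finset.card_add_card_compl]
      simp
    by_cases hI : k ≤ I.card
    · refine pk_of_finset I hI (fun i => (M i).comap Sum.inl) ?_ ?_ ?_
      · intro i _ a b hab
        have := m1 i hab
        simpa [G'] using this
      · intro i j hij a b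
        exact m2 i j hij _ _
      · intro i hi
        exact Mn.pull _ Sum.inl_injective (Finset.mem_filter.1 hi).2
    · exfalso
      apply hA'
      refine pk_of_finset Iᶜ (by omega) (fun i => (M i).comap (fun w => Sum.inr (Sum.inl w))) ?_ ?_ ?_
      · intro i _ a b hab
        have := m1 i hab
        simpa [G'] using this
      · intro i j hij a b
        exact m2 i j hij _ _
      · intro i hi
        refine Mn.pull _ (Sum.inr_injective.comp Sum.inl_injective) ((dich i).resolve_left ?_)
        simpa [I] using hi
  · right
    have hXN : X.ncard < N := by
      have := Nat.le_floor hXc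
      omega
    refine ⟨Sym2.map Sum.inl ⁻¹' X, ?_, ?_, ?_⟩
    · intro e he
      induction e with
      | _ a b =>
        have := hXG he
        simpa [G'] using this
    · refine le_trans ?_ hXc
      exact_mod_cast Set.ncard_le_ncard_of_injOn (Sym2.map Sum.inl) (fun a ha => ha)
        (Sym2.map.injective Sum.inl_injective).injOn (Set.toFinite X)
    · rw [isMinor_induce]
      intro hC
      apply hXm
      rw [isMinor_iff]
      have h1 : Mn H c.supp (G'.deleteEdges X) (Set.range Sum.inl) := by
        refine (hC.push Sum.inl Sum.inl_injective.injOn ?_).weaken (Set.image_subset_range _ _)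
        intro a _ b _ hab
        rw [SimpleGraph.deleteEdges_adj] at hab ⊢
        exact ⟨by simpa [G'] using hab.1, by simpa using hab.2⟩
      have h2 : Mn H R (G'.deleteEdges X) (Set.range (fun w => Sum.inr (Sum.inl w))) := by
        refine hA.survive G' _ ?_ ?_ X hXN
        · intro a b hab
          simpa using hab
        · intro a b hab
          simpa [G'] using hab
      have h3 : Mn H S (G'.deleteEdges X) (Set.range (fun w => Sum.inr (Sum.inr w))) := by
        refine (copies_pk H S N).survive G' _ ?_ ?_ X hXN
        · intro a b hab
          simpa using hab
        · intro a b hab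
          simpa [G'] using hab
      have h12 := h1.union h2 (by
          rw [Set.disjoint_left]
          rintro _ ⟨a, rfl⟩ ⟨b, hb⟩
          simp at hb) (by
          intro u hu v hv
          have hu' : H.connectedComponentMk u = c := hu
          refine ⟨?_, ?_⟩
          · rintro rfl
            exact hv.1 hu'
          · intro h
            exact hv.1 ((ConnectedComponent.sound h.symm.reachable).trans hu'))
      have h123 := h12.union h3 (by
          rw [Set.disjoint_left]
          rintro _ (⟨a, rfl⟩ | ⟨a, rfl⟩) ⟨b, hb⟩ <;>
          simp at hb) (by
          intro u hu v hv
          have hub : big (H.connectedComponentMk u) := by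
            rcases hu with hu | hu
            · have hu' : H.connectedComponentMk u = c := hu
              rw [hu']
              exact hcbig
            · exact hu.2
          refine ⟨?_, ?_⟩
          · rintro rfl
            exact hv hub
          · intro h
            apply hv
            rw [← ConnectedComponent.sound h.reachable]
            exact hub)
      have huniv : (c.supp ∪ R) ∪ S = Set.univ := by
        ext v
        simp only [Set.mem_union, Set.mem_univ, iff_true]
        by_cases hb : big (H.connectedComponentMk v)
        · left
          by_cases hv : H.connectedComponentMk v = c
          · exact Or.inl hv
          · exact Or.inr ⟨hv, hb⟩
        · exact Or.inr hb
      rw [huniv] at h123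
      exact h123.weaken (Set.subset_univ _)
end

section
/- Let 𝓟 be a hereditary graph property and let H be a graph that contains a block with property 𝓟. Suppose furthermore that for every block A of H with property 𝓟 there is a generic counterexample. Then the class 𝓕_H does not have the edge-Erdős–Pósa property. -/
open SimpleGraph

/-- `v` is a cutvertex of `G`: some two other vertices are connected in `G` but not
in `G - v`. -/
def IsCutvertex {V : Type} (G : SimpleGraph V) (v : V) : Prop :=
  ∃ a b : {w : V | w ≠ v}, G.Reachable a.1 b.1 ∧
    ¬ (G.induce {w : V | w ≠ v}).Reachable a b

/-- A block of `H`: a maximal connected subgraph of `H` without a cutvertex. -/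
def IsBlock {V : Type} (H : SimpleGraph V) (B : H.Subgraph) : Prop :=
  B.coe.Connected ∧ (∀ v, ¬ IsCutvertex B.coe v) ∧
  ∀ B' : H.Subgraph, B ≤ B' → B'.coe.Connected → (∀ v, ¬ IsCutvertex B'.coe v) →
    B' = B

/-- There is a generic counterexample for a block `A` of `H`: for some `k` and every `r`
there is a graph `A*` without `k` edge-disjoint `A`-expansions, together with a vertex
`s'` of `A*` for every cutvertex `s` of `H` lying in `A`, such that after deleting any
at most `r - 1` edges there is a model of `A` whose branch set at each such `s`
contains `s'`. -/
def GenericCounterexample {V : Type} (H : SimpleGraph V) (A : H.Subgraph) : Prop :=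
  ∃ k : ℕ, ∀ r : ℕ, ∃ (W : Type) (_ : Fintype W) (Astar : SimpleGraph W)
    (s' : {s : V // s ∈ A.verts ∧ IsCutvertex H s} → W),
    ¬ EdgeDisjointExpansions A.coe Astar k ∧
    ∀ X : Set (Sym2 W), X ⊆ Astar.edgeSet → X.ncard < r →
      ∃ B : A.verts → Set W, IsModel A.coe (Astar.deleteEdges X) B ∧
        ∀ s : {s : V // s ∈ A.verts ∧ IsCutvertex H s}, s' s ∈ B ⟨s.1, s.2.1⟩


def PC {V : Type} (r : V → V → Prop) (T : Set V) : Prop :=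
  ∀ Y : Set V, (∃ y ∈ T, y ∈ Y) → (∀ y ∈ T, ∀ z ∈ T, y ∈ Y → r y z → z ∈ Y) → T ⊆ Y

def TC {V : Type} (r : V → V → Prop) (T : Set V) : Prop :=
  T.Nonempty ∧ PC r T ∧ ∀ x, PC r (T \ {x})

theorem preconn_iff {V : Type} (G : SimpleGraph V) : G.Preconnected ↔ PC G.Adj Set.univ := by
  constructor
  · rintro h Y ⟨y, -, hy⟩ hc z -
    obtain ⟨p⟩ := h y z
    induction p with
    | nil => exact hy
    | cons hadj p ih => exact ih (hc _ trivial _ trivial hy hadj)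
  · intro h a b
    exact h {z | G.Reachable a z} ⟨a, trivial, Reachable.refl _⟩
      (fun y _ z _ hy hz => hy.trans hz.reachable) (Set.mem_univ b)

theorem PC.sub {V : Type} {r : V → V → Prop} {T : Set V} (p : V → Prop) (hp : ∀ v, p v ↔ v ∈ T)
    (r' : Subtype p → Subtype p → Prop) (hr : ∀ a b, r' a b ↔ r a.1 b.1) :
    PC r' Set.univ ↔ PC r T := by
  constructor
  · rintro h Y ⟨y, hyT, hy⟩ hc z hz
    have := h {a | a.1 ∈ Y} ⟨⟨y, (hp y).2 hyT⟩, trivial, hy⟩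
      (fun a _ b _ ha hab => hc _ ((hp _).1 a.2) _ ((hp _).1 b.2) ha ((hr _ _).1 hab))
    exact this (Set.mem_univ ⟨z, (hp z).2 hz⟩)
  · rintro h Y ⟨y, -, hy⟩ hc z -
    have := h {a | ∃ ha : p a, (⟨a, ha⟩ : Subtype p) ∈ Y} ⟨y.1, (hp _).1 y.2, y.2, hy⟩
      (by
        rintro a haT b hbT ⟨ha, haY⟩ hab
        exact ⟨(hp _).2 hbT, hc _ trivial _ trivial haY ((hr _ _).2 hab)⟩)
    exact (this ((hp _).1 z.2)).2

theorem induce_preconn {V : Type} (G : SimpleGraph V) (T : Set V) :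
    (G.induce T).Preconnected ↔ PC G.Adj T := by
  rw [preconn_iff]
  exact PC.sub (fun v => v ∈ T) (fun _ => Iff.rfl) _ (fun _ _ => Iff.rfl)

theorem induce_conn {V : Type} (G : SimpleGraph V) (T : Set V) :
    (G.induce T).Connected ↔ T.Nonempty ∧ PC G.Adj T := by
  rw [connected_iff, induce_preconn, Set.nonempty_coe_sort, and_comm]

theorem isModel_iff {V W : Type} (H : SimpleGraph V) (G : SimpleGraph W) (B : V → Set W) :
    IsModel H G B ↔ (∀ v, (B v).Nonempty) ∧ (∀ v, PC G.Adj (B v)) ∧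
      (∀ u v w, w ∈ B u → w ∈ B v → u = v) ∧
      (∀ u v, H.Adj u v → ∃ a ∈ B u, ∃ b ∈ B v, G.Adj a b) := by
  unfold IsModel
  constructor
  · rintro ⟨h1, h2, h3, h4⟩
    refine ⟨h1, fun v => ((induce_conn _ _).1 (h2 v)).2, ?_, h4⟩
    intro u v w hu hv
    by_contra hne
    exact Set.disjoint_left.1 (h3 hne) hu hv
  · rintro ⟨h1, h2, h3, h4⟩
    refine ⟨h1, fun v => (induce_conn _ _).2 ⟨h1 v, h2 v⟩, ?_, h4⟩
    intro u v hne
    exact Set.disjoint_left.2 fun w hu hv => hne (h3 u v w hu hv)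

theorem sub_conn {V : Type} {H : SimpleGraph V} (B : H.Subgraph) :
    B.coe.Connected ↔ B.verts.Nonempty ∧ PC B.Adj B.verts := by
  rw [connected_iff, preconn_iff, Set.nonempty_coe_sort, and_comm]
  exact and_congr_right fun _ => PC.sub (fun v => v ∈ B.verts) (fun _ => Iff.rfl) _ (fun _ _ => Iff.rfl)

theorem sub_tc {V : Type} {H : SimpleGraph V} (B : H.Subgraph) :
    (B.coe.Connected ∧ ∀ v, ¬ IsCutvertex B.coe v) ↔ TC B.Adj B.verts := by
  rw [sub_conn, TC, and_assoc]
  refine and_congr_right fun hne => and_congr_right fun hpc => ?_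
  have hconn := (sub_conn B).2 ⟨hne, hpc⟩
  have key : ∀ v : B.verts, ¬ IsCutvertex B.coe v ↔ PC B.Adj (B.verts \ {v.1}) := by
    intro v
    have e1 : ¬ IsCutvertex B.coe v ↔ (B.coe.induce {w | w ≠ v}).Preconnected := by
      unfold IsCutvertex
      push Not
      exact ⟨fun h a b => h a b (hconn.preconnected _ _), fun h a b _ => h a b⟩
    rw [e1, induce_preconn]
    constructor
    · rintro h Y ⟨y, hyT, hy⟩ hc z hz
      have := h {a | a.1 ∈ Y} ⟨⟨y, hyT.1⟩, fun e => hyT.2 (by simp [← e]), hy⟩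
        (fun a ha b hb haY hab => hc _ ⟨a.2, fun e => ha (Subtype.ext e)⟩ _
          ⟨b.2, fun e => hb (Subtype.ext e)⟩ haY hab)
      exact @this ⟨z, hz.1⟩ (fun e => hz.2 (by simp [← e]))
    · rintro h Y ⟨y, hyT, hy⟩ hc z hz
      have := h {a | ∃ ha : a ∈ B.verts, (⟨a, ha⟩ : B.verts) ∈ Y}
        ⟨y.1, ⟨y.2, fun e => hyT (Subtype.ext e)⟩, y.2, hy⟩
        (by
          rintro a haT b hbT ⟨ha, haY⟩ hab
          exact ⟨hbT.1, hc ⟨a, ha⟩ (fun e => haT.2 (by simp [← e])) _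
            (fun e => hbT.2 (by simp [← e])) haY hab⟩)
      exact (this ⟨z.2, fun e => hz (Subtype.ext e)⟩).2
  constructor
  · intro h x
    by_cases hx : x ∈ B.verts
    · exact (key ⟨x, hx⟩).1 (h _)
    · rwa [Set.sdiff_singleton_eq_self hx]
  · intro h v
    exact (key v).2 (h _)

theorem isBlock_iff {V : Type} {H : SimpleGraph V} (B : H.Subgraph) :
    IsBlock H B ↔ TC B.Adj B.verts ∧ ∀ B' : H.Subgraph, B ≤ B' → TC B'.Adj B'.verts → B' = B := by
  unfold IsBlock
  rw [← and_assoc, sub_tc]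
  refine and_congr_right fun _ => forall_congr' fun B' => forall_congr' fun _ => ?_
  rw [← sub_tc]
  tauto

/-- transport of preconnectedness -/
theorem PC.mono {V : Type} {r r' : V → V → Prop} {T : Set V} (h : PC r T)
    (hr : ∀ a ∈ T, ∀ b ∈ T, r a b → r' a b) : PC r' T :=
  fun Y hy hc => h Y hy fun y hyT z hzT hyY hyz => hc y hyT z hzT hyY (hr _ hyT _ hzT hyz)

theorem PC.image {V W : Type} {r : V → V → Prop} {r' : W → W → Prop} {T : Set V} (f : V → W)
    (h : PC r T) (hr : ∀ a ∈ T, ∀ b ∈ T, r a b → r' (f a) (f b)) : PC r' (f '' T) := by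
  rintro Y ⟨_, ⟨y, hyT, rfl⟩, hy⟩ hc _ ⟨z, hz, rfl⟩
  exact h {a | f a ∈ Y} ⟨y, hyT, hy⟩ (fun a ha b hb haY hab =>
    hc _ ⟨a, ha, rfl⟩ _ ⟨b, hb, rfl⟩ haY (hr _ ha _ hb hab)) hz

/-- the union of an indexed family over a connected index set -/
theorem PC.biUnion {V W : Type} {r : V → V → Prop} {r' : W → W → Prop} {T : Set V}
    (f : V → Set W) (h : PC r T) (hf : ∀ a ∈ T, PC r' (f a))
    (hr : ∀ a ∈ T, ∀ b ∈ T, r a b → ∃ x ∈ f a, ∃ y ∈ f b, r' x y) : PC r' (⋃ a ∈ T, f a) := by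
  rintro Y ⟨y, hyT, hy⟩ hc z hz
  simp only [Set.mem_iUnion] at hyT hz
  obtain ⟨a, haT, ha⟩ := hyT
  obtain ⟨b, hbT, hb⟩ := hz
  have hloc : ∀ c ∈ T, ∀ x ∈ f c, x ∈ Y → f c ⊆ Y := by
    intro c hcT x hx hxY
    exact hf c hcT Y ⟨x, hx, hxY⟩ (fun p hp q hq => hc p (Set.mem_biUnion hcT hp) q
      (Set.mem_biUnion hcT hq))
  have := h {c | f c ⊆ Y} ⟨a, haT, hloc a haT y ha hy⟩ (by
    intro c hcT d hdT hcY hcd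
    obtain ⟨x, hx, x', hx', hxx⟩ := hr c hcT d hdT hcd
    exact hloc d hdT x' hx' (hc x (Set.mem_biUnion hcT hx) x' (Set.mem_biUnion hdT hx') (hcY hx) hxx))
  exact this hbT hb

theorem PC.singleton {V : Type} {r : V → V → Prop} (x : V) : PC r {x} := by
  rintro Y ⟨y, rfl, hy⟩ - z rfl
  exact hy

/-- everything connected to a connected core -/
theorem PC.of_core {V : Type} {r : V → V → Prop} {T S : Set V}
    (h : PC r S) (hS : S ⊆ T)
    (hr : ∀ a ∈ T, ∃ Q ⊆ T, a ∈ Q ∧ PC r Q ∧ (Q ∩ S).Nonempty) : PC r T := by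
  rintro Y ⟨y, hyT, hy⟩ hc z hz
  have hcl : ∀ Q ⊆ T, PC r Q → ∀ q ∈ Q, q ∈ Y → Q ⊆ Y := fun Q hQ hpc q hq hqY =>
    hpc Y ⟨q, hq, hqY⟩ fun a ha b hb => hc a (hQ ha) b (hQ hb)
  obtain ⟨Q, hQ, hyQ, hQc, s, hsQ, hsS⟩ := hr y hyT
  have h1 : S ⊆ Y := hcl S hS h s hsS (hcl Q hQ hQc y hyQ hy hsQ)
  obtain ⟨Q', hQ', hzQ, hQc', s', hsQ', hsS'⟩ := hr z hz
  exact hcl Q' hQ' hQc' s' hsQ' (h1 hsS') hzQ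

theorem IsMinor.refl' {V : Type} (H : SimpleGraph V) : IsMinor H H := by
  refine ⟨fun v => {v}, (isModel_iff _ _ _).2 ⟨fun v => ⟨v, rfl⟩, fun v => PC.singleton v, ?_, ?_⟩⟩
  · rintro u v w rfl h
    exact h
  · intro u v h
    exact ⟨u, rfl, v, rfl, h⟩

theorem IsMinor.trans' {U V W : Type} {A : SimpleGraph U} {B : SimpleGraph V} {C : SimpleGraph W}
    (h1 : IsMinor A B) (h2 : IsMinor B C) : IsMinor A C := by
  obtain ⟨f, hf⟩ := h1
  obtain ⟨g, hg⟩ := h2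
  rw [isModel_iff] at hf hg
  obtain ⟨f1, f2, f3, f4⟩ := hf
  obtain ⟨g1, g2, g3, g4⟩ := hg
  refine ⟨fun u => ⋃ a ∈ f u, g a, (isModel_iff _ _ _).2 ⟨?_, ?_, ?_, ?_⟩⟩
  · intro u
    obtain ⟨a, ha⟩ := f1 u
    obtain ⟨b, hb⟩ := g1 a
    exact ⟨b, Set.mem_biUnion ha hb⟩
  · intro u
    exact PC.biUnion g (f2 u) (fun a _ => g2 a) (fun a _ b _ h => g4 a b h)
  · intro u v w hu hv
    simp only [Set.mem_iUnion] at hu hv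
    obtain ⟨a, ha, hwa⟩ := hu
    obtain ⟨b, hb, hwb⟩ := hv
    obtain rfl := g3 _ _ _ hwa hwb
    exact f3 _ _ _ ha hb
  · intro u v h
    obtain ⟨a, ha, b, hb, hab⟩ := f4 u v h
    obtain ⟨x, hx, y, hy, hxy⟩ := g4 a b hab
    exact ⟨x, Set.mem_biUnion ha hx, y, Set.mem_biUnion hb hy, hxy⟩

/-- pull back a model along an injection whose range contains the model -/
theorem IsModel.pull {U V W : Type} {A : SimpleGraph U} {N : SimpleGraph W} {N' : SimpleGraph V}
    {B : U → Set W} (hB : IsModel A N B) (f : V → W) (hf : Function.Injective f)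
    (hr : ∀ u, B u ⊆ Set.range f)
    (hN : ∀ a b, (∃ u, f a ∈ B u) → (∃ u, f b ∈ B u) → N.Adj (f a) (f b) → N'.Adj a b) :
    IsModel A N' (fun u => f ⁻¹' B u) := by
  rw [isModel_iff] at hB ⊢
  obtain ⟨f1, f2, f3, f4⟩ := hB
  refine ⟨?_, ?_, ?_, ?_⟩
  · intro u
    obtain ⟨w, hw⟩ := f1 u
    obtain ⟨v, rfl⟩ := hr u hw
    exact ⟨v, hw⟩
  · rintro u Y ⟨y, hyT, hy⟩ hc z hz
    have := f2 u (f '' Y) ⟨f y, hyT, y, hy, rfl⟩ (by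
      rintro _ ha b hb ⟨a, haY, rfl⟩ hab
      obtain ⟨b, rfl⟩ := hr u hb
      exact ⟨b, hc a ha b hb haY (hN _ _ ⟨u, ha⟩ ⟨u, hb⟩ hab), rfl⟩)
    obtain ⟨z', hz', e⟩ := this hz
    rwa [← hf e]
  · intro u v w hu hv
    exact f3 _ _ _ hu hv
  · intro u v h
    obtain ⟨a, ha, b, hb, hab⟩ := f4 u v h
    obtain ⟨a, rfl⟩ := hr u ha
    obtain ⟨b, rfl⟩ := hr v hb
    exact ⟨a, ha, b, hb, hN _ _ ⟨u, ha⟩ ⟨v, hb⟩ hab⟩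

section blocks
variable {V : Type} {H : SimpleGraph V}

theorem block_absorb {A C : H.Subgraph} (hA : IsBlock H A) (hnt : A.verts.Nontrivial)
    (hC : ∀ x, ∀ a ∈ C.verts, a ≠ x →
      ∃ Q ⊆ C.verts \ {x}, a ∈ Q ∧ PC C.Adj Q ∧ (Q ∩ A.verts).Nonempty) : C ≤ A := by
  rw [isBlock_iff] at hA
  obtain ⟨⟨h1, h2, h3⟩, hmax⟩ := hA
  have hm : ∀ (S : Set V), PC A.Adj S → PC (A ⊔ C).Adj S := fun S h =>
    h.mono fun a _ b _ h => by simp [h]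
  have hm' : ∀ (S : Set V), PC C.Adj S → PC (A ⊔ C).Adj S := fun S h =>
    h.mono fun a _ b _ h => by simp [h]
  have key : A ⊔ C = A := by
    apply hmax _ le_sup_left
    refine ⟨?_, ?_, ?_⟩
    · obtain ⟨a, ha⟩ := h1
      exact ⟨a, Or.inl ha⟩
    · refine PC.of_core (hm _ h2) (fun a ha => Or.inl ha) ?_
      rintro a (ha | ha)
      · exact ⟨A.verts, fun a ha => Or.inl ha, ha, hm _ h2, a, ha, ha⟩
      · obtain ⟨x, hx, hxa⟩ := hnt.exists_ne a
        obtain ⟨Q, hQ, haQ, hQc, y, hy, hyA⟩ := hC x a ha hxa.symm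
        exact ⟨Q, fun q hq => Or.inr (hQ hq).1, haQ, hm' _ hQc, y, hy, hyA⟩
    · intro x
      refine PC.of_core (hm _ (h3 x)) (fun a ha => ⟨Or.inl ha.1, ha.2⟩) ?_
      rintro a ⟨ha | ha, hax⟩
      · exact ⟨A.verts \ {x}, fun a ha => ⟨Or.inl ha.1, ha.2⟩, ⟨ha, hax⟩, hm _ (h3 x), a, ⟨ha, hax⟩, ⟨ha, hax⟩⟩
      · obtain ⟨Q, hQ, haQ, hQc, y, hy, hyA⟩ := hC x a ha hax
        exact ⟨Q, fun q hq => ⟨Or.inr (hQ hq).1, (hQ hq).2⟩, haQ, hm' _ hQc, y, hy, hyA, (hQ hy).2⟩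
  exact key ▸ le_sup_right

theorem walk_pc {u v : V} (p : H.Walk u v) {C : H.Subgraph} (h : p.toSubgraph ≤ C) :
    PC C.Adj {x | x ∈ p.support} := by
  have h1 := ((sub_conn p.toSubgraph).1 (p.toSubgraph_connected).coe).2
  rw [Walk.verts_toSubgraph] at h1
  exact h1.mono fun a _ b _ hab => h.2 hab

theorem block_path {A : H.Subgraph} (hA : IsBlock H A) {u w : V} (hu : u ∈ A.verts)
    (hw : w ∈ A.verts) (huw : u ≠ w) (p : H.Walk u w) (hp : p.IsPath) : p.toSubgraph ≤ A := by
  classical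
  refine block_absorb hA ⟨u, hu, w, hw, huw⟩ ?_
  intro x a ha hax
  have ha' : a ∈ p.support := by simpa using ha
  have hspec : (p.takeUntil a ha').toSubgraph ⊔ (p.dropUntil a ha').toSubgraph = p.toSubgraph := by
    rw [← Walk.toSubgraph_append, Walk.take_spec]
  by_cases hx : x ∈ (p.takeUntil a ha').support
  · refine ⟨{y | y ∈ (p.dropUntil a ha').support}, ?_, Walk.start_mem_support _,
      walk_pc _ (hspec ▸ le_sup_right), w, Walk.end_mem_support _, hw⟩
    intro y hy
    refine ⟨by simpa using Walk.support_dropUntil_subset p ha' hy, ?_⟩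
    rintro rfl
    rw [← Walk.take_spec p ha'] at hp
    have hnd := hp.support_nodup
    rw [Walk.support_append] at hnd
    have hy' : y ∈ (p.dropUntil a ha').support.tail := by
      have := hy
      simp only [Set.mem_setOf_eq] at this
      rw [Walk.mem_support_iff] at this
      rcases this with rfl | h
      · exact absurd rfl hax
      · exact h
    exact (List.disjoint_of_nodup_append hnd) hx hy'
  · refine ⟨{y | y ∈ (p.takeUntil a ha').support}, ?_, Walk.end_mem_support _,
      walk_pc _ (hspec ▸ le_sup_left), u, Walk.start_mem_support _, hu⟩
    intro y hy
    refine ⟨by simpa using Walk.support_takeUntil_subset p ha' hy, ?_⟩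
    rintro rfl
    exact hx hy

/-- `H` minus the edges of the subgraph `A` -/
def minusE (H : SimpleGraph V) (A : H.Subgraph) : SimpleGraph V where
  Adj a b := H.Adj a b ∧ ¬ A.Adj a b
  symm := ⟨fun _ _ h => ⟨h.1.symm, fun h' => h.2 h'.symm⟩⟩
  loopless := ⟨fun _ h => h.1.ne rfl⟩

theorem minusE_le (A : H.Subgraph) : minusE H A ≤ H := fun _ _ h => h.1

theorem block_sep {A : H.Subgraph} (hA : IsBlock H A) {u w : V} (hu : u ∈ A.verts)
    (hw : w ∈ A.verts) (h : (minusE H A).Reachable u w) : u = w := by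
  classical
  by_contra huw
  obtain ⟨p, hp⟩ := h.exists_isPath
  cases p with
  | nil => exact huw rfl
  | cons hadj q =>
    have := block_path hA hu hw huw _ (Walk.IsPath.mapLe (minusE_le A) hp)
    exact hadj.2 (this.2 (by simp))

theorem block_eq {A B : H.Subgraph} (hA : IsBlock H A) (hB : IsBlock H B) {u w : V} (huw : u ≠ w)
    (hu : u ∈ A.verts) (hw : w ∈ A.verts) (hu' : u ∈ B.verts) (hw' : w ∈ B.verts) : A = B := by
  have : B ≤ A := by
    refine block_absorb hA ⟨u, hu, w, hw, huw⟩ fun x a ha hax => ?_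
    refine ⟨B.verts \ {x}, subset_rfl, ⟨ha, hax⟩, ((isBlock_iff B).1 hB).1.2.2 x, ?_⟩
    by_cases hux : u = x
    · exact ⟨w, ⟨hw', fun h => huw (hux.trans h.symm)⟩, hw⟩
    · exact ⟨u, ⟨hu', hux⟩, hu⟩
  exact ((isBlock_iff B).1 hB).2 A this ((isBlock_iff A).1 hA).1

theorem block_nbr {A : H.Subgraph} (hA : IsBlock H A) (hnt : A.verts.Nontrivial) {v : V}
    (hv : v ∈ A.verts) : ∃ v', A.Adj v v' := by
  obtain ⟨⟨h1, h2, h3⟩, hmax⟩ := (isBlock_iff A).1 hA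
  by_contra hcon
  push Not at hcon
  obtain ⟨x, hx, hxa⟩ := hnt.exists_ne v
  refine hxa (h2 {v} ⟨v, hv, rfl⟩ ?_ hx)
  rintro y _ z _ rfl hyz
  exact absurd hyz (hcon z)

theorem block_cut {A : H.Subgraph} (hA : IsBlock H A) (hnt : A.verts.Nontrivial) {v v' : V}
    (hv : v ∈ A.verts) (hadj : H.Adj v v') (hn : ¬ A.Adj v v') : IsCutvertex H v := by
  classical
  obtain ⟨a, ha, hav⟩ := hnt.exists_ne v
  have hc := ((isBlock_iff A).1 hA).1
  have hconn := ((sub_tc A).2 hc).1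
  have hva : H.Reachable v a := by
    have := (hconn.preconnected ⟨v, hv⟩ ⟨a, ha⟩).map A.hom
    simpa using this
  refine ⟨⟨v', hadj.ne'⟩, ⟨a, hav⟩, hadj.symm.reachable.trans hva, fun hr => ?_⟩
  obtain ⟨p, hp⟩ := hr.exists_isPath
  have hp2 := Walk.map_isPath_of_injective (f := (SimpleGraph.Embedding.induce {w | w ≠ v}).toHom)
    Subtype.val_injective hp
  have hvn : v ∉ (p.map (SimpleGraph.Embedding.induce (G := H) {w | w ≠ v}).toHom).support := by
    rw [Walk.support_map]
    intro hmem
    obtain ⟨b, _, hb⟩ := List.mem_map.1 hmem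
    exact b.2 hb
  have := block_path hA hv ha hav.symm (Walk.cons hadj (p.map (SimpleGraph.Embedding.induce (G := H) {w | w ≠ v}).toHom))
    (hp2.cons hvn)
  exact hn (this.2 (by simp))

theorem block_cut2 {A B : H.Subgraph} (hA : IsBlock H A) (hB : IsBlock H B)
    (hnt : A.verts.Nontrivial) (hnt' : B.verts.Nontrivial) (hne : A ≠ B) {v : V}
    (hv : v ∈ A.verts) (hv' : v ∈ B.verts) : IsCutvertex H v := by
  obtain ⟨w, hw⟩ := block_nbr hB hnt' hv'
  refine block_cut hA hnt hv hw.adj_sub fun h => hne ?_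
  exact block_eq hA hB hw.adj_sub.ne hv h.snd_mem hv' hw.snd_mem

theorem exists_block [Finite V] {C : H.Subgraph} (hC : TC C.Adj C.verts) :
    ∃ B, IsBlock H B ∧ C ≤ B := by
  have hfin : (setOf fun B : H.Subgraph => TC B.Adj B.verts).Finite := Set.toFinite _
  obtain ⟨B, hCB, hB⟩ := hfin.exists_le_maximal hC
  refine ⟨B, (isBlock_iff B).2 ⟨hB.prop, fun B' h h' => ?_⟩, hCB⟩
  exact le_antisymm (hB.le_of_ge h' h) h

end blocks

theorem pc_of_not_cut {U : Type} {A : SimpleGraph U} (hA : A.Connected) {v : U}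
    (hv : ¬ IsCutvertex A v) : PC A.Adj {w | w ≠ v} := by
  rw [← induce_preconn]
  unfold IsCutvertex at hv
  push Not at hv
  exact fun a b => hv a b (hA.preconnected _ _)

theorem remove_side {U W : Type} {A : SimpleGraph U} {N : SimpleGraph W} {ν : U → Set W}
    (hν : IsModel A N ν) {v0 : U} {x : W} (hx : x ∈ ν v0) (S : Set W)
    (hxS : x ∉ S) (hS : ∀ v, v ≠ v0 → ∀ w ∈ ν v, w ∉ S)
    (hcl : ∀ a ∈ S, ∀ v, ∀ b ∈ ν v, b ≠ x → N.Adj a b → b ∈ S) :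
    IsModel A N (fun v => ν v \ S) := by
  rw [isModel_iff] at hν ⊢
  obtain ⟨f1, f2, f3, f4⟩ := hν
  refine ⟨?_, ?_, ?_, ?_⟩
  · intro v
    by_cases hv : v = v0
    · subst hv
      exact ⟨x, hx, hxS⟩
    · obtain ⟨w, hw⟩ := f1 v
      exact ⟨w, hw, hS v hv w hw⟩
  · intro v
    by_cases hv : v = v0
    · subst hv
      rintro Y ⟨y, hyT, hy⟩ hc
      have hxY : x ∈ Y := by
        by_contra hxY
        have := f2 v ((ν v \ S) ∩ Y) ⟨y, hyT.1, hyT, hy⟩ (by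
          rintro a haν b hbν ⟨ha, haY⟩ hab
          have hbS : b ∉ S := fun hbS => ha.2 (hcl b hbS v a haν (fun h => hxY (h ▸ haY)) hab.symm)
          exact ⟨⟨hbν, hbS⟩, hc a ha b ⟨hbν, hbS⟩ haY hab⟩)
        exact hxY (this hx).2
      have := f2 v (Y ∪ S) ⟨y, hyT.1, Or.inl hy⟩ (by
        rintro a haν b hbν ha hab
        by_cases hbS : b ∈ S
        · exact Or.inr hbS
        by_cases haS : a ∈ S
        · by_cases hbx : b = x
          · exact Or.inl (hbx ▸ hxY)
          · exact Or.inr (hcl a haS v b hbν hbx hab)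
        · exact Or.inl (hc a ⟨haν, haS⟩ b ⟨hbν, hbS⟩ (ha.resolve_right haS) hab))
      intro z hz
      exact (this hz.1).resolve_right hz.2
    · have : ν v \ S = ν v := by
        ext w
        exact ⟨fun h => h.1, fun h => ⟨h, hS v hv w h⟩⟩
      rw [this]
      exact f2 v
  · intro u v w hu hv
    exact f3 u v w hu.1 hv.1
  · intro u v huv
    obtain ⟨a, ha, b, hb, hab⟩ := f4 u v huv
    have aux : ∀ u v a b, A.Adj u v → a ∈ ν u → b ∈ ν v → N.Adj a b → a ∉ S := by
      intro u v a b huv ha hb hab haS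
      have hu : u = v0 := by
        by_contra h
        exact hS u h a ha haS
      subst hu
      have hbx : b ≠ x := by
        rintro rfl
        exact huv.ne (f3 _ _ _ hx hb)
      exact hS v huv.ne' b hb (hcl a haS v b hb hbx hab)
    exact ⟨a, ⟨ha, aux u v a b huv ha hb hab⟩, b, ⟨hb, aux v u b a huv.symm hb ha hab.symm⟩, hab⟩

theorem min_model {U W : Type} [Finite W] {A : SimpleGraph U} (hA : A.Connected)
    (hA' : ∀ v, ¬ IsCutvertex A v) {N : SimpleGraph W} {ν : U → Set W} (hν : IsModel A N ν) :
    ∃ ν' : U → Set W, IsModel A N ν' ∧ (∀ v, ν' v ⊆ ⋃ u, ν u) ∧ TC N.Adj (⋃ u, ν' u) := by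
  let 𝒵 : Set (Set W) := {Z | ∃ ν' : U → Set W, IsModel A N ν' ∧ (⋃ u, ν' u) = Z}
  have hfin : 𝒵.Finite := Set.toFinite _
  obtain ⟨Z, hZle, hZ⟩ := hfin.exists_le_minimal (a := ⋃ u, ν u) ⟨ν, hν, rfl⟩
  obtain ⟨ν', hν', rfl⟩ := hZ.prop
  have hm := hν'
  rw [isModel_iff] at hm
  obtain ⟨f1, f2, f3, f4⟩ := hm
  have hpc : PC N.Adj (⋃ u, ν' u) := by
    have := PC.biUnion (r' := N.Adj) ν' ((preconn_iff A).1 hA.preconnected) (fun a _ => f2 a)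
      (fun a _ b _ h => f4 a b h)
    simpa using this
  refine ⟨ν', hν', fun v => (Set.subset_iUnion ν' v).trans hZle, ?_, hpc, ?_⟩
  · obtain ⟨u⟩ := hA.nonempty
    obtain ⟨w, hw⟩ := f1 u
    exact ⟨w, Set.mem_iUnion.2 ⟨u, hw⟩⟩
  intro x
  by_cases hxZ : x ∈ ⋃ u, ν' u
  swap
  · rwa [Set.sdiff_singleton_eq_self hxZ]
  obtain ⟨v0, hx⟩ := Set.mem_iUnion.1 hxZ
  -- no removable side
  have key : ∀ S : Set W, x ∉ S → (∀ v, v ≠ v0 → ∀ w ∈ ν' v, w ∉ S) →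
      (∀ a ∈ S, ∀ v, ∀ b ∈ ν' v, b ≠ x → N.Adj a b → b ∈ S) → ∀ a ∈ ⋃ u, ν' u, a ∉ S := by
    intro S h1 h2 h3 a ha haS
    have := remove_side hν' hx S h1 h2 h3
    have hle : (⋃ u, ν' u \ S) ≤ ⋃ u, ν' u := Set.iUnion_mono fun u => Set.sdiff_subset
    have := hZ.le_of_le ⟨_, this, rfl⟩ hle
    obtain ⟨u, hu⟩ := Set.mem_iUnion.1 (this ha)
    exact hu.2 haS
  rintro Y ⟨y, ⟨hyZ, hyx⟩, hy⟩ hc z ⟨hzZ, hzx⟩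
  have hmem : ∀ v, v ≠ v0 → ∀ w ∈ ν' v, w ∈ (⋃ u, ν' u) \ {x} := by
    intro v hv w hw
    refine ⟨Set.mem_iUnion.2 ⟨v, hw⟩, ?_⟩
    rintro rfl
    exact hv (f3 _ _ _ hw hx)
  have hloc : ∀ v, v ≠ v0 → ∀ w ∈ ν' v, w ∈ Y → ν' v ⊆ Y := by
    intro v hv w hw hwY
    exact f2 v Y ⟨w, hw, hwY⟩ (fun a ha b hb => hc a (hmem v hv a ha) b (hmem v hv b hb))
  by_cases hex : ∃ v, v ≠ v0 ∧ ∃ w ∈ ν' v, w ∈ Y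
  · obtain ⟨v1, hv1, w1, hw1, hw1Y⟩ := hex
    have hall : {v | v ≠ v0} ⊆ {v | ν' v ⊆ Y} := by
      refine pc_of_not_cut hA (hA' v0) _ ⟨v1, hv1, hloc v1 hv1 w1 hw1 hw1Y⟩ ?_
      intro a ha b hb haY hab
      obtain ⟨p, hp, q, hq, hpq⟩ := f4 a b hab
      exact hloc b hb q hq (hc p (hmem a ha p hp) q (hmem b hb q hq) (haY hp) hpq)
    by_contra hzY
    refine key {w | w ∈ (⋃ u, ν' u) \ {x} ∧ w ∉ Y} (fun h => h.1.2 rfl) ?_ ?_ z hzZ ⟨⟨hzZ, hzx⟩, hzY⟩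
    · intro v hv w hw h
      exact h.2 (hall hv hw)
    · rintro a ⟨ha, haY⟩ v b hb hbx hab
      have hb' : b ∈ (⋃ u, ν' u) \ {x} := ⟨Set.mem_iUnion.2 ⟨v, hb⟩, hbx⟩
      exact ⟨hb', fun hbY => haY (hc b hb' a ha hbY hab.symm)⟩
  · push Not at hex
    exfalso
    refine key {w | w ∈ (⋃ u, ν' u) \ {x} ∧ w ∈ Y} (fun h => h.1.2 rfl) ?_ ?_ y hyZ ⟨⟨hyZ, hyx⟩, hy⟩
    · intro v hv w hw h
      exact hex v hv w hw h.2
    · rintro a ⟨ha, haY⟩ v b hb hbx hab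
      have hb' : b ∈ (⋃ u, ν' u) \ {x} := ⟨Set.mem_iUnion.2 ⟨v, hb⟩, hbx⟩
      exact ⟨hb', hc a ha b hb' haY hab⟩

theorem edgeDisj_iff {U W : Type} (A : SimpleGraph U) (G : SimpleGraph W) (k : ℕ) :
    EdgeDisjointExpansions A G k ↔ ∃ N : Fin k → SimpleGraph W, (∀ l, N l ≤ G) ∧
      (∀ l l', l ≠ l' → ∀ a b, (N l).Adj a b → ¬ (N l').Adj a b) ∧ ∀ l, IsMinor A (N l) := by
  constructor
  · rintro ⟨M, hd, hm⟩
    refine ⟨fun l => (M l).spanningCoe, fun l => (M l).spanningCoe_le, ?_, fun l => ?_⟩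
    · intro l l' hl a b hab hab'
      have h1 : s(a, b) ∈ (M l).edgeSet := by simpa using hab
      have h2 : s(a, b) ∈ (M l').edgeSet := by simpa using hab'
      exact Set.disjoint_left.1 (hd hl) h1 h2
    · refine (hm l).trans' ?_
      refine ⟨fun v => {v.1}, (isModel_iff _ _ _).2 ⟨fun v => ⟨_, rfl⟩, fun v => PC.singleton _, ?_, ?_⟩⟩
      · rintro u v w rfl h
        exact Subtype.ext h
      · intro u v h
        exact ⟨_, rfl, _, rfl, h⟩
  · rintro ⟨N, hN, hd, hm⟩
    refine ⟨fun l => SimpleGraph.toSubgraph (N l) (hN l), ?_, fun l => ?_⟩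
    · intro l l' hl
      refine Set.disjoint_left.2 fun e => ?_
      induction e with
      | _ a b =>
        intro h h'
        exact hd l l' hl a b (by simpa using h) (by simpa using h')
    · refine (hm l).trans' ?_
      refine ⟨fun v => {⟨v, trivial⟩}, (isModel_iff _ _ _).2 ⟨fun v => ⟨_, rfl⟩, fun v => PC.singleton _, ?_, ?_⟩⟩
      · rintro u v w rfl h
        exact congrArg Subtype.val h
      · intro u v h
        exact ⟨_, rfl, _, rfl, h⟩

theorem generic_big {V : Type} {H : SimpleGraph V} {A : H.Subgraph} (hA : TC A.Adj A.verts)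
    (hg : GenericCounterexample H A) (a b : V) : ∃ c ∈ A.verts, c ≠ a ∧ c ≠ b := by
  classical
  by_contra hcon
  push Not at hcon
  obtain ⟨k, hk⟩ := hg
  obtain ⟨W, _, G, s', hno, hrob⟩ := hk (k + 1)
  rw [edgeDisj_iff] at hno
  by_cases hadj : ∃ x y, A.Adj x y
  · obtain ⟨x, y, hxy⟩ := hadj
    have hv : ∀ v ∈ A.verts, v = x ∨ v = y := by
      intro v hv
      have h1 := or_iff_not_imp_left.2 (hcon v hv)
      have h2 := or_iff_not_imp_left.2 (hcon x hxy.fst_mem)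
      have h3 := or_iff_not_imp_left.2 (hcon y hxy.snd_mem)
      have h4 := hxy.adj_sub.ne
      clear hrob hno hk hcon
      grind
    by_cases hc : k ≤ G.edgeSet.ncard
    · apply hno
      have hcard : Fintype.card (Fin k) ≤ Fintype.card G.edgeSet := by
        rw [← Nat.card_eq_fintype_card (α := G.edgeSet)]
        rw [Fintype.card_fin]
        exact hc
      obtain ⟨e⟩ := Function.Embedding.nonempty_of_card_le hcard
      refine ⟨fun l => fromEdgeSet {(e l).1}, ?_, ?_, ?_⟩
      · intro l p q h
        rw [fromEdgeSet_adj] at h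
        have : s(p, q) = (e l).1 := h.1
        rw [← mem_edgeSet, this]
        exact (e l).2
      · intro l l' hl p q h h'
        rw [fromEdgeSet_adj] at h h'
        have h1 : s(p, q) = (e l).1 := h.1
        have h2 : s(p, q) = (e l').1 := h'.1
        exact hl (e.injective (Subtype.ext (h1.symm.trans h2)))
      · intro l
        obtain ⟨⟨p, q⟩, hpq⟩ : ∃ pq : W × W, s(pq.1, pq.2) = (e l).1 :=
          ⟨(Quot.out (e l).1), Quot.out_eq _⟩
        have hG : G.Adj p q := by
          rw [← mem_edgeSet]
          exact hpq ▸ (e l).2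
        have hl : (fromEdgeSet {(e l).1}).Adj p q := by
          rw [fromEdgeSet_adj]
          exact ⟨hpq, hG.ne⟩
        refine ⟨fun v => {if v.1 = x then p else q}, (isModel_iff _ _ _).2
          ⟨fun v => ⟨_, rfl⟩, fun v => PC.singleton _, ?_, ?_⟩⟩
        · rintro ⟨u, hu⟩ ⟨v, hv'⟩ w rfl h
          have hne := hG.ne
          rcases hv u hu with rfl | rfl <;> rcases hv v hv' with rfl | rfl <;>
            simp_all [hxy.adj_sub.ne', hG.ne']
        · rintro ⟨u, hu⟩ ⟨v, hv'⟩ h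
          refine ⟨_, rfl, _, rfl, ?_⟩
          have h' : u ≠ v := (show A.Adj u v from h).adj_sub.ne
          rcases hv u hu with rfl | rfl <;> rcases hv v hv' with rfl | rfl
          · exact absurd rfl h'
          · simpa [h'.symm] using hl
          · simpa [h'] using hl.symm
          · exact absurd rfl h'
    · obtain ⟨B, hB, -⟩ := hrob G.edgeSet subset_rfl (by omega)
      obtain ⟨p, -, q, -, hpq⟩ := hB.2.2.2 ⟨x, hxy.fst_mem⟩ ⟨y, hxy.snd_mem⟩ hxy
      simp at hpq
  · push Not at hadj
    apply hno
    obtain ⟨B, hB, -⟩ := hrob ∅ (Set.empty_subset _) (by simp)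
    obtain ⟨v, hv⟩ := hA.1
    obtain ⟨w, -⟩ := hB.1 ⟨v, hv⟩
    refine ⟨fun _ => ⊥, fun l => bot_le, fun l l' _ p q h => by simp at h, fun l => ?_⟩
    refine ⟨fun v => {w}, (isModel_iff _ _ _).2 ⟨fun v => ⟨_, rfl⟩, fun v => PC.singleton _, ?_, ?_⟩⟩
    · rintro ⟨u, hu⟩ ⟨u', hu'⟩ w' - -
      have := hA.2.1 {u} ⟨u, hu, rfl⟩ (fun y _ z _ _ h => absurd h (hadj y z)) hu'
      exact Subtype.ext (Eq.symm this)
    · rintro ⟨u, hu⟩ ⟨u', hu'⟩ h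
      exact absurd h (hadj u u')

structure Su {VH : Type} (H : SimpleGraph VH) where
  ι : Type
  fι : Finite ι
  S : ι → H.Subgraph
  hS : ∀ i, IsBlock H (S i)
  hinj : Function.Injective S
  hbig : ∀ i a b, ∃ c ∈ (S i).verts, c ≠ a ∧ c ≠ b
  W : ι → Type
  fW : ∀ i, Finite (W i)
  As : ∀ i, SimpleGraph (W i)
  s' : ∀ i, {s : VH // s ∈ (S i).verts ∧ IsCutvertex H s} → W i
  s'_inj : ∀ i, Function.Injective (s' i)
  r : ℕ

namespace Su
variable {VH : Type} {H : SimpleGraph VH} (σ : Su H)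

theorem nt (i : σ.ι) : (σ.S i).verts.Nontrivial := by
  obtain ⟨v, hv⟩ := ((isBlock_iff _).1 (σ.hS i)).1.1
  obtain ⟨c, hc, hne, -⟩ := σ.hbig i v v
  exact ⟨v, hv, c, hc, hne.symm⟩

def D : SimpleGraph VH where
  Adj u v := ∃ i, (σ.S i).Adj u v
  symm := ⟨fun _ _ ⟨i, h⟩ => ⟨i, h.symm⟩⟩
  loopless := ⟨fun _ ⟨_, h⟩ => h.adj_sub.ne rfl⟩

def F : SimpleGraph VH where
  Adj u v := H.Adj u v ∧ ¬ σ.D.Adj u v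
  symm := ⟨fun _ _ h => ⟨h.1.symm, fun h' => h.2 h'.symm⟩⟩
  loopless := ⟨fun _ h => h.1.ne rfl⟩

def K (u : VH) : SimpleGraph VH where
  Adj a b := H.Adj a b ∧ ¬ (σ.F.Adj a b ∧ σ.F.Reachable u a)
  symm := ⟨fun _ _ h => ⟨h.1.symm, fun h' => h.2 ⟨h'.1.symm, h'.2.trans h'.1.reachable⟩⟩⟩
  loopless := ⟨fun _ h => h.1.ne rfl⟩

def U (u : VH) : Prop := ∃ i, u ∈ (σ.S i).verts ∧ IsCutvertex H u

abbrev GV : Type := VH ⊕ (Σ i, σ.W i) ⊕ (VH × Fin σ.r)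

instance [Finite VH] : Finite σ.GV := by
  have := σ.fι
  have := σ.fW
  infer_instance

abbrev tm (u : VH) : σ.GV := Sum.inl u
abbrev cp (u : VH) (t : Fin σ.r) : σ.GV := Sum.inr (Sum.inr (u, t))

open Classical in
noncomputable def φ (i : σ.ι) (w : σ.W i) : σ.GV :=
  if h : ∃ s, σ.s' i s = w then Sum.inl h.choose.1 else Sum.inr (Sum.inl ⟨i, w⟩)

theorem φ_s' (i : σ.ι) (s) : σ.φ i (σ.s' i s) = σ.tm s.1 := by
  unfold φ
  have h : ∃ x, σ.s' i x = σ.s' i s := ⟨s, rfl⟩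
  rw [dif_pos h, σ.s'_inj i h.choose_spec]

theorem φ_tm {i : σ.ι} {w : σ.W i} {u : VH} (h : σ.φ i w = σ.tm u) :
    ∃ hu, σ.s' i ⟨u, hu⟩ = w := by
  unfold φ at h
  split_ifs at h with h'
  · have e : h'.choose.1 = u := Sum.inl.inj h
    subst e
    exact ⟨h'.choose.2, h'.choose_spec⟩

theorem φ_cases (i : σ.ι) (w : σ.W i) :
    (∃ s, w = σ.s' i s ∧ σ.φ i w = σ.tm s.1) ∨ σ.φ i w = Sum.inr (Sum.inl ⟨i, w⟩) := by
  by_cases h : ∃ s, σ.s' i s = w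
  · obtain ⟨s, rfl⟩ := h
    exact Or.inl ⟨s, rfl, σ.φ_s' i s⟩
  · right
    unfold φ
    rw [dif_neg h]

theorem φ_cp {i : σ.ι} {w : σ.W i} {u : VH} {t} (h : σ.φ i w = σ.cp u t) : False := by
  rcases σ.φ_cases i w with ⟨s, -, e⟩ | e <;> rw [e] at h <;> simp at h

theorem φ_eq {i j : σ.ι} {w : σ.W i} {w' : σ.W j} (h : σ.φ i w = σ.φ j w') :
    (∃ e : i = j, e ▸ w = w') ∨ ∃ s t, s.1 = t.1 ∧ w = σ.s' i s ∧ w' = σ.s' j t := by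
  rcases σ.φ_cases i w with ⟨s, hs, e⟩ | e <;> rcases σ.φ_cases j w' with ⟨t, ht, e'⟩ | e' <;>
    rw [e, e'] at h
  · exact Or.inr ⟨s, t, Sum.inl.inj h, hs, ht⟩
  · simp at h
  · simp at h
  · left
    have := Sum.inl.inj (Sum.inr.inj h)
    obtain ⟨rfl, h2⟩ := Sigma.mk.inj this
    exact ⟨rfl, eq_of_heq h2⟩

theorem φ_inj (i : σ.ι) : Function.Injective (σ.φ i) := by
  intro a b h
  rcases σ.φ_eq h with ⟨_, h'⟩ | ⟨s, t, hst, rfl, rfl⟩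
  · exact h'
  · rw [Subtype.ext hst]

def G : SimpleGraph σ.GV where
  Adj x y := (∃ i a b, (σ.As i).Adj a b ∧ x = σ.φ i a ∧ y = σ.φ i b) ∨
    (∃ t a b, σ.F.Adj a b ∧ x = σ.cp a t ∧ y = σ.cp b t) ∨
    (∃ u t, σ.U u ∧ ((x = σ.tm u ∧ y = σ.cp u t) ∨ (x = σ.cp u t ∧ y = σ.tm u)))
  symm := ⟨by
    rintro x y (⟨i, a, b, h, hx, hy⟩ | ⟨t, a, b, h, hx, hy⟩ | ⟨u, t, hu, h⟩)
    · exact Or.inl ⟨i, b, a, h.symm, hy, hx⟩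
    · exact Or.inr (Or.inl ⟨t, b, a, h.symm, hy, hx⟩)
    · exact Or.inr (Or.inr ⟨u, t, hu, h.symm.imp (fun h => ⟨h.2, h.1⟩) (fun h => ⟨h.2, h.1⟩)⟩)⟩
  loopless := ⟨by
    rintro x (⟨i, a, b, h, hx, hy⟩ | ⟨t, a, b, h, hx, hy⟩ | ⟨u, t, hu, h⟩)
    · exact h.ne (σ.φ_inj i (hx.symm.trans hy))
    · rw [hx] at hy
      exact h.ne (by simpa using hy)
    · rcases h with ⟨h1, h2⟩ | ⟨h1, h2⟩ <;> rw [h1] at h2 <;> simp at h2⟩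

theorem G_cp {v : VH} {t : Fin σ.r} {y : σ.GV} (h : σ.G.Adj (σ.cp v t) y) :
    (∃ b, σ.F.Adj v b ∧ y = σ.cp b t) ∨ (σ.U v ∧ y = σ.tm v) := by
  rcases h with ⟨i, a, b, h, hx, hy⟩ | ⟨t', a, b, h, hx, hy⟩ | ⟨u, t', hu, h⟩
  · exact (σ.φ_cp hx.symm).elim
  · simp only [cp, Sum.inr.injEq, Prod.mk.injEq] at hx
    obtain ⟨rfl, rfl⟩ := hx
    exact Or.inl ⟨b, h, hy⟩
  · rcases h with ⟨h1, h2⟩ | ⟨h1, h2⟩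
    · simp at h1
    · simp only [cp, Sum.inr.injEq, Prod.mk.injEq] at h1
      obtain ⟨rfl, rfl⟩ := h1
      exact Or.inr ⟨hu, h2⟩

theorem G_φ {i : σ.ι} {a b : σ.W i} (h : σ.G.Adj (σ.φ i a) (σ.φ i b)) : (σ.As i).Adj a b := by
  have hne : a ≠ b := fun e => h.ne (by rw [e])
  rcases h with ⟨j, a', b', h, hx, hy⟩ | ⟨t', a', b', h, hx, hy⟩ | ⟨u, t', hu, h⟩
  · by_cases hij : i = j
    · subst hij
      rwa [σ.φ_inj _ hx, σ.φ_inj _ hy]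
    · rcases σ.φ_eq hx with ⟨e, -⟩ | ⟨s, t, hst, rfl, rfl⟩
      · exact absurd e hij
      rcases σ.φ_eq hy with ⟨e, -⟩ | ⟨s2, t2, hst2, rfl, rfl⟩
      · exact absurd e hij
      exact absurd (σ.hinj (block_eq (σ.hS i) (σ.hS j) (u := s.1) (w := s2.1)
        (fun e => hne (by rw [Subtype.ext e])) s.2.1 s2.2.1 (hst ▸ t.2.1) (hst2 ▸ t2.2.1))) hij
  · exact (σ.φ_cp hx).elim
  · rcases h with ⟨h1, h2⟩ | ⟨h1, h2⟩
    · exact (σ.φ_cp h2).elim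
    · exact (σ.φ_cp h1).elim

theorem S_reach {i j : σ.ι} (hij : i ≠ j) {u w : VH} (hu : u ∈ (σ.S j).verts)
    (hw : w ∈ (σ.S j).verts) : (minusE H (σ.S i)).Reachable u w := by
  have hc := ((sub_tc _).2 ((isBlock_iff _).1 (σ.hS j)).1).1
  let f : (σ.S j).coe →g minusE H (σ.S i) := ⟨Subtype.val, by
    intro a b hab
    have hab' : (σ.S j).Adj a b := hab
    refine ⟨hab'.adj_sub, fun h => hij (σ.hinj ?_)⟩
    exact block_eq (σ.hS i) (σ.hS j) hab'.adj_sub.ne h.fst_mem h.snd_mem a.2 b.2⟩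
  exact (hc.preconnected ⟨u, hu⟩ ⟨w, hw⟩).map f

theorem S_reachD {j : σ.ι} {u w : VH} (hu : u ∈ (σ.S j).verts)
    (hw : w ∈ (σ.S j).verts) : σ.D.Reachable u w := by
  have hc := ((sub_tc _).2 ((isBlock_iff _).1 (σ.hS j)).1).1
  let f : (σ.S j).coe →g σ.D := ⟨Subtype.val, by
    intro a b hab
    exact ⟨j, hab⟩⟩
  exact (hc.preconnected ⟨u, hu⟩ ⟨w, hw⟩).map f

theorem F_le_minusE (i : σ.ι) : σ.F ≤ minusE H (σ.S i) := by
  intro a b h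
  exact ⟨h.1, fun h' => h.2 ⟨i, h'⟩⟩

theorem region_sep {u w : VH} (h : σ.F.Reachable u w) (hK : (σ.K u).Reachable u w) : u = w := by
  classical
  by_contra huw
  obtain ⟨p, hp⟩ := hK.exists_isPath
  cases p with
  | nil => exact huw rfl
  | @cons _ y _ hadj q =>
    have hD : σ.D.Adj u y := by
      by_contra hD
      exact hadj.2 ⟨⟨hadj.1, hD⟩, Reachable.refl _⟩
    obtain ⟨i, hi⟩ := hD
    have hq : u ∉ q.support := ((Walk.cons_isPath_iff _ _).1 hp).2
    have hw : (minusE H (σ.S i)).Reachable u w := h.mono (σ.F_le_minusE i)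
    have hy : y ∉ {v | ¬ (minusE H (σ.S i)).Reachable u v}ᶜ := by
      intro h'
      simp only [Set.mem_compl_iff, Set.mem_ofPred_eq, not_not] at h'
      exact hi.adj_sub.ne (block_sep (σ.hS i) hi.fst_mem hi.snd_mem h')
    obtain ⟨d, hd, h1, h2⟩ := q.exists_boundary_dart {v | ¬ (minusE H (σ.S i)).Reachable u v}
      (by simpa using hy) (by simpa using hw)
    simp only [Set.mem_ofPred_eq, not_not] at h1 h2
    have hdi : (σ.S i).Adj d.fst d.snd := by
      by_contra hdi
      have : (minusE H (σ.S i)).Adj d.snd d.fst := ⟨d.adj.1.symm, fun h => hdi h.symm⟩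
      exact h1 (h2.trans this.reachable)
    have := block_sep (σ.hS i) hi.fst_mem hdi.snd_mem h2
    have hm := q.dart_snd_mem_support_of_mem_darts hd
    rw [← this] at hm
    exact hq hm

end Su

theorem PC.cross {V : Type} {r : V → V → Prop} {T : Set V} (h : PC r T) (Y : Set V)
    {y z : V} (hy : y ∈ T) (hyY : y ∈ Y) (hz : z ∈ T) (hzY : z ∉ Y) :
    ∃ a ∈ T, a ∈ Y ∧ ∃ b ∈ T, b ∉ Y ∧ r a b := by
  by_contra hc
  push Not at hc
  exact hzY (h Y ⟨y, hy, hyY⟩ (fun a ha b hb haY hab => by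
    by_contra hbY
    exact hc a ha haY b hb hbY hab) hz)

namespace Su
variable {VH : Type} {H : SimpleGraph VH} (σ : Su H)

theorem vne (i : σ.ι) : (σ.S i).verts.Nonempty := ((isBlock_iff _).1 (σ.hS i)).1.1

noncomputable def pr : σ.GV → VH
  | Sum.inl u => u
  | Sum.inr (Sum.inl x) => (σ.vne x.1).choose
  | Sum.inr (Sum.inr x) => x.1

theorem pr_φ (i : σ.ι) (w : σ.W i) : σ.pr (σ.φ i w) ∈ (σ.S i).verts := by
  rcases σ.φ_cases i w with ⟨s, -, e⟩ | e <;> rw [e]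
  · exact s.2.1
  · exact (σ.vne i).choose_spec

theorem core1 {N : SimpleGraph σ.GV} (hN : N ≤ σ.G) {Z : Set σ.GV} (hZ : TC N.Adj Z)
    (h3 : ∀ a b, ∃ z ∈ Z, z ≠ a ∧ z ≠ b) {v : VH} {t : Fin σ.r} (hv : σ.cp v t ∈ Z)
    (hR : ¬ ∀ z ∈ Z, ∃ v', σ.F.Reachable v v' ∧ z = σ.cp v' t) :
    ∃ u w, u ≠ w ∧ σ.U u ∧ σ.U w ∧ σ.F.Reachable u w ∧ σ.tm u ∈ Z ∧ σ.tm w ∈ Z := by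
  have hcr : ∀ T ⊆ Z, PC N.Adj T → ∀ y ∈ T, (∃ v', σ.F.Reachable v v' ∧ y = σ.cp v' t) →
      ∀ z ∈ T, (¬ ∃ v', σ.F.Reachable v v' ∧ z = σ.cp v' t) →
      ∃ u, σ.F.Reachable v u ∧ σ.U u ∧ σ.cp u t ∈ T ∧ σ.tm u ∈ T := by
    intro T hT hpc y hy hyR z hz hzR
    obtain ⟨a, ha, ⟨u, hu, rfl⟩, b, hb, hbR, hab⟩ :=
      hpc.cross {y | ∃ v', σ.F.Reachable v v' ∧ y = σ.cp v' t} hy hyR hz hzR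
    rcases σ.G_cp (hN hab) with ⟨b', hb', rfl⟩ | ⟨hU, rfl⟩
    · exact (hbR ⟨b', hu.trans hb'.reachable, rfl⟩).elim
    · exact ⟨u, hu, hU, ha, hb⟩
  push Not at hR
  obtain ⟨z0, hz0, hz0R⟩ := hR
  have hz0R' : ¬ ∃ v', σ.F.Reachable v v' ∧ z0 = σ.cp v' t := by
    rintro ⟨v', h1, h2⟩
    exact hz0R v' h1 h2
  obtain ⟨u, hu, hU, hc, htm⟩ := hcr Z subset_rfl hZ.2.1 _ hv ⟨v, Reachable.refl _, rfl⟩ _ hz0 hz0R'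
  have htmR : ∀ x, ¬ ∃ v', σ.F.Reachable v v' ∧ σ.tm x = σ.cp v' t := by
    rintro x ⟨v', -, h⟩
    simp at h
  by_cases hex : ∃ y ∈ Z, y ≠ σ.cp u t ∧ ∃ v', σ.F.Reachable v v' ∧ y = σ.cp v' t
  · obtain ⟨y, hy, hyn, hyR⟩ := hex
    obtain ⟨w, hw, hUw, hcw, htw⟩ := hcr (Z \ {σ.cp u t}) Set.sdiff_subset (hZ.2.2 _) y ⟨hy, hyn⟩ hyR
      (σ.tm u) ⟨htm, by simp⟩ (htmR u)
    refine ⟨u, w, ?_, hU, hUw, hu.symm.trans hw, htm, htw.1⟩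
    rintro rfl
    exact hcw.2 rfl
  · exfalso
    obtain ⟨z, hz, hz1, hz2⟩ := h3 (σ.cp u t) (σ.tm u)
    obtain ⟨w, hw, hUw, hcw, htw⟩ := hcr (Z \ {σ.tm u}) Set.sdiff_subset (hZ.2.2 _) (σ.cp u t)
      ⟨hc, by simp⟩ ⟨u, hu, rfl⟩ z ⟨hz, hz2⟩ (fun h => hex ⟨z, hz, hz1, h⟩)
    by_cases hwu : w = u
    · subst hwu
      exact htw.2 rfl
    · exact hex ⟨σ.cp w t, hcw.1, by simpa using hwu, w, hw, rfl⟩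

theorem core2 {N : SimpleGraph σ.GV} (hN : N ≤ σ.G) {Z : Set σ.GV} (hZ : TC N.Adj Z)
    (h3 : ∀ a b, ∃ z ∈ Z, z ≠ a ∧ z ≠ b) (hcp : ∀ v t, σ.cp v t ∉ Z) :
    ∃ i, Z ⊆ Set.range (σ.φ i) := by
  classical
  have hpiece : ∀ a ∈ Z, ∀ b ∈ Z, N.Adj a b → ∃ i a' b', a = σ.φ i a' ∧ b = σ.φ i b' := by
    intro a ha b hb hab
    rcases hN hab with ⟨i, a', b', h, hx, hy⟩ | ⟨t', a', b', h, hx, hy⟩ | ⟨u, t', hu, h⟩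
    · exact ⟨i, a', b', hx, hy⟩
    · exact (hcp _ _ (hx ▸ ha)).elim
    · rcases h with ⟨h1, h2⟩ | ⟨h1, h2⟩
      · exact (hcp _ _ (h2 ▸ hb)).elim
      · exact (hcp _ _ (h1 ▸ ha)).elim
  obtain ⟨z0, hz0⟩ := hZ.1
  obtain ⟨z1, hz1, hne, -⟩ := h3 z0 z0
  obtain ⟨x, hx, hxz, x', hx', hxz', hadj⟩ := hZ.2.1.cross {z0} hz0 rfl hz1 hne
  have hxx : x ≠ x' := hadj.ne
  obtain ⟨i, a, a', rfl, rfl⟩ := hpiece x hx x' hx' hadj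
  refine ⟨i, ?_⟩
  intro y hy
  by_contra hyr
  let Y : Set σ.GV := {z | (∀ w, z ≠ Sum.inr (Sum.inl ⟨i, w⟩)) ∧
    (minusE H (σ.S i)).Reachable (σ.pr y) (σ.pr z)}
  have hYr : ∀ w, σ.φ i w ∈ Y → ∃ u, u ∈ (σ.S i).verts ∧ σ.φ i w = σ.tm u ∧
      (minusE H (σ.S i)).Reachable (σ.pr y) u := by
    intro w hw
    rcases σ.φ_cases i w with ⟨s, -, e⟩ | e
    · refine ⟨s.1, s.2.1, e, ?_⟩
      have := hw.2
      rwa [e] at this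
    · exact (hw.1 w e).elim
  have hYu : ∀ w w', σ.φ i w ∈ Y → σ.φ i w' ∈ Y → σ.φ i w = σ.φ i w' := by
    intro w w' hw hw'
    obtain ⟨u, hu, e, h⟩ := hYr w hw
    obtain ⟨u', hu', e', h'⟩ := hYr w' hw'
    rw [e, e', block_sep (σ.hS i) hu hu' (h.symm.trans h')]
  have hyY : y ∈ Y := by
    refine ⟨?_, Reachable.refl _⟩
    rintro w rfl
    obtain ⟨z, hz, hzy, -⟩ := h3 (Sum.inr (Sum.inl ⟨i, w⟩)) (Sum.inr (Sum.inl ⟨i, w⟩))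
    obtain ⟨p, hp, hp1, q, hq, -, hpq⟩ := hZ.2.1.cross {(Sum.inr (Sum.inl ⟨i, w⟩) : σ.GV)} hy (Set.mem_singleton _) hz hzy
    obtain ⟨j, p', q', rfl, rfl⟩ := hpiece p hp q hq hpq
    have hp2 : σ.φ j p' = Sum.inr (Sum.inl ⟨i, w⟩) := hp1
    rcases σ.φ_cases j p' with ⟨s, hs, e⟩ | e
    · rw [e] at hp2; simp at hp2
    · have e' := e
      rw [hp2] at e'
      have hij := (Sigma.mk.inj (Sum.inl.inj (Sum.inr.inj e'))).1
      subst hij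
      exact hyr ⟨p', hp2⟩
  obtain ⟨e, he, hee⟩ : ∃ e, e ≠ y ∧ ∀ w, σ.φ i w ∈ Y → σ.φ i w = e := by
    by_cases hex : ∃ w, σ.φ i w ∈ Y
    · obtain ⟨w, hw⟩ := hex
      exact ⟨σ.φ i w, fun h => hyr ⟨w, h⟩, fun w' hw' => hYu _ _ hw' hw⟩
    · push Not at hex
      exact ⟨σ.φ i a, fun h => hyr ⟨a, h⟩, fun w hw => (hex w hw).elim⟩
  have hsub : Z \ {e} ⊆ Y := by
    refine hZ.2.2 e Y ⟨y, ⟨hy, he.symm⟩, hyY⟩ ?_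
    intro p hp q hq hpY hpq
    obtain ⟨j, p', q', rfl, rfl⟩ := hpiece p hp.1 q hq.1 hpq
    by_cases hij : i = j
    · subst hij
      exact (hp.2 (hee _ hpY)).elim
    · refine ⟨?_, hpY.2.trans (σ.S_reach hij (σ.pr_φ j p') (σ.pr_φ j q'))⟩
      intro w hw
      rcases σ.φ_cases j q' with ⟨s, -, e⟩ | e
      · rw [e] at hw; simp at hw
      · rw [e] at hw
        have := Sum.inl.inj (Sum.inr.inj hw)
        exact hij (Sigma.mk.inj this).1.symm
  by_cases hae : σ.φ i a = e
  · have hm : σ.φ i a' ∈ Y := hsub ⟨hx', fun h => hxx (hae.trans (Eq.symm h))⟩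
    exact hxx (hae.trans (hee _ hm).symm)
  · exact hae (hee _ (hsub ⟨hx, hae⟩))

theorem core [Finite VH] {N : SimpleGraph σ.GV} (hN : N ≤ σ.G) (i0 : σ.ι)
    {ν : (σ.S i0).verts → Set σ.GV} (hν : IsModel (σ.S i0).coe N ν)
    (hF : ¬ IsMinor (σ.S i0).coe σ.F) :
    (∃ j, IsMinor (σ.S i0).coe (N.comap (σ.φ j))) ∨
    ∃ u w, u ≠ w ∧ σ.U u ∧ σ.U w ∧ σ.F.Reachable u w ∧ (∃ v, σ.tm u ∈ ν v) ∧ (∃ v, σ.tm w ∈ ν v) := by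
  obtain ⟨ν', hν', hsub, hZ⟩ := min_model (σ.hS i0).1 (σ.hS i0).2.1 hν
  have hm := (isModel_iff _ _ _).1 hν'
  have h3 : ∀ a b, ∃ z ∈ ⋃ u, ν' u, z ≠ a ∧ z ≠ b := by
    intro a b
    have hown : ∀ a : σ.GV, ∃ va : VH, ∀ v : (σ.S i0).verts, a ∈ ν' v → v.1 = va := by
      intro a
      by_cases h : ∃ v, a ∈ ν' v
      · obtain ⟨v, hv⟩ := h
        exact ⟨v.1, fun v' hv' => by rw [hm.2.2.1 v' v a hv' hv]⟩
      · obtain ⟨x, hx⟩ := σ.vne i0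
        exact ⟨x, fun v' hv' => (h ⟨v', hv'⟩).elim⟩
    obtain ⟨va, hva⟩ := hown a
    obtain ⟨vb, hvb⟩ := hown b
    obtain ⟨c, hc, h1, h2⟩ := σ.hbig i0 va vb
    obtain ⟨z, hz⟩ := hm.1 ⟨c, hc⟩
    refine ⟨z, Set.mem_iUnion.2 ⟨_, hz⟩, ?_, ?_⟩
    · rintro rfl
      exact h1 (hva _ hz)
    · rintro rfl
      exact h2 (hvb _ hz)
  by_cases hcp : ∃ v t, σ.cp v t ∈ ⋃ u, ν' u
  · right
    obtain ⟨v, t, hv⟩ := hcp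
    by_cases hR : ∀ z ∈ ⋃ u, ν' u, ∃ v', σ.F.Reachable v v' ∧ z = σ.cp v' t
    · exfalso
      apply hF
      refine ⟨_, hν'.pull (fun v => σ.cp v t) ?_ ?_ ?_⟩
      · intro a b h
        simpa using h
      · intro u z hz
        obtain ⟨v', -, rfl⟩ := hR z (Set.mem_iUnion.2 ⟨u, hz⟩)
        exact ⟨v', rfl⟩
      · intro a b _ _ hab
        rcases σ.G_cp (hN hab) with ⟨b', hb', h⟩ | ⟨hU, h⟩
        · have : b = b' := by simpa using h
          rwa [this]
        · simp at h
    · obtain ⟨u, w, h1, h2, h3, h4, h5, h6⟩ := σ.core1 hN hZ h3 hv hR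
      refine ⟨u, w, h1, h2, h3, h4, ?_, ?_⟩
      · obtain ⟨v, hv⟩ := Set.mem_iUnion.1 h5
        exact Set.mem_iUnion.1 (hsub v hv)
      · obtain ⟨v, hv⟩ := Set.mem_iUnion.1 h6
        exact Set.mem_iUnion.1 (hsub v hv)
  · left
    push Not at hcp
    obtain ⟨j, hj⟩ := σ.core2 hN hZ h3 hcp
    exact ⟨j, _, hν'.pull (σ.φ j) (σ.φ_inj j) (fun u z hz => hj (Set.mem_iUnion.2 ⟨u, hz⟩))
      (fun a b _ _ h => h)⟩

end Su

theorem lin_contra {Q : Type} [Fintype Q] [DecidableEq Q] [Nonempty Q] (a b : Q → Q)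
    (g : Q → Q → ℚ) (h : ∀ c c', g c (a c') - g c (b c') = if c = c' then 1 else 0) : False := by
  let X : Matrix Q Q ℚ := fun d c => (if d = a c then 1 else 0) - (if d = b c then 1 else 0)
  let Gm : Matrix Q Q ℚ := fun c d => g c d
  have h1 : Gm * X = 1 := by
    ext c c'
    rw [Matrix.mul_apply, Matrix.one_apply, ← h]
    simp [X, Gm, mul_sub, Finset.sum_sub_distrib]
  have h2 : X * Gm = 1 := mul_eq_one_comm.1 h1
  obtain ⟨q⟩ := ‹Nonempty Q›
  have h3 : ∑ d, (X * Gm) d q = 0 := by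
    simp only [Matrix.mul_apply]
    rw [Finset.sum_comm]
    refine Finset.sum_eq_zero fun c _ => ?_
    rw [← Finset.sum_mul]
    simp [X, Finset.sum_sub_distrib]
  rw [h2] at h3
  simp [Matrix.one_apply] at h3

namespace Su
variable {VH : Type} {H : SimpleGraph VH} (σ : Su H)

theorem D_le : σ.D ≤ H := fun _ _ ⟨_, h⟩ => h.adj_sub

theorem D_le_K (u : VH) : σ.D ≤ σ.K u := fun _ _ h => ⟨σ.D_le h, fun h' => h'.1.2 h⟩

theorem F_K {u a b : VH} (h : σ.F.Reachable a b) (hu : ¬ σ.F.Reachable u a) :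
    (σ.K u).Reachable a b := by
  obtain ⟨p⟩ := h
  induction p with
  | nil => exact Reachable.refl _
  | @cons x y z hadj q ih =>
    have h1 : (σ.K u).Adj x y := ⟨hadj.1, fun h => hu h.2⟩
    exact h1.reachable.trans (ih fun h => hu (h.trans hadj.symm.reachable))

theorem count [Finite VH] [Nonempty σ.ι] {N : SimpleGraph σ.GV} (hN : N ≤ σ.G)
    {μ : VH → Set σ.GV} (hμ : IsModel H N μ) (hF : ∀ i, ¬ IsMinor (σ.S i).coe σ.F) :
    ∃ i j, IsMinor (σ.S i).coe (N.comap (σ.φ j)) := by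
  classical
  by_contra hcon
  push Not at hcon
  rw [isModel_iff] at hμ
  let Q := {c : σ.D.ConnectedComponent // ∃ i, ∃ v ∈ (σ.S i).verts, σ.D.connectedComponentMk v = c}
  have : Finite Q := inferInstance
  have : Fintype Q := Fintype.ofFinite Q
  have hU : ∀ {u}, σ.U u → ∃ i, ∃ v ∈ (σ.S i).verts,
      σ.D.connectedComponentMk v = σ.D.connectedComponentMk u := by
    rintro u ⟨i, hu, -⟩
    exact ⟨i, u, hu, rfl⟩
  have : Nonempty Q := by
    obtain ⟨i⟩ := ‹Nonempty σ.ι›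
    obtain ⟨v, hv⟩ := σ.vne i
    exact ⟨⟨_, i, v, hv, rfl⟩⟩
  have key : ∀ c : Q, ∃ u w, u ≠ w ∧ σ.U u ∧ σ.U w ∧ σ.F.Reachable u w ∧
      (∃ v, σ.D.connectedComponentMk v = c.1 ∧ σ.tm u ∈ μ v) ∧
      (∃ v, σ.D.connectedComponentMk v = c.1 ∧ σ.tm w ∈ μ v) := by
    rintro ⟨c, i, v, hv, rfl⟩
    have hm : IsModel (σ.S i).coe N (fun x => μ x.1) := by
      rw [isModel_iff]
      refine ⟨fun x => hμ.1 _, fun x => hμ.2.1 _, fun x y z hx hy => Subtype.ext (hμ.2.2.1 _ _ _ hx hy),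
        fun x y h => hμ.2.2.2 _ _ (Subgraph.Adj.adj_sub h)⟩
    rcases σ.core hN i hm (hF i) with ⟨j, hj⟩ | ⟨u, w, h1, h2, h3, h4, ⟨x, hx⟩, ⟨y, hy⟩⟩
    · exact (hcon i j hj).elim
    · refine ⟨u, w, h1, h2, h3, h4, ⟨x.1, ?_, hx⟩, ⟨y.1, ?_, hy⟩⟩
      · exact ConnectedComponent.sound (σ.S_reachD x.2 hv)
      · exact ConnectedComponent.sound (σ.S_reachD y.2 hv)
  choose u w hne hUu hUw hFr hu hw using key
  have hdis : ∀ {c c' : Q} {x : VH}, (∃ v, σ.D.connectedComponentMk v = c.1 ∧ σ.tm x ∈ μ v) →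
      (∃ v, σ.D.connectedComponentMk v = c'.1 ∧ σ.tm x ∈ μ v) → c = c' := by
    rintro c c' x ⟨v, h1, h2⟩ ⟨v', h1', h2'⟩
    have := hμ.2.2.1 _ _ _ h2 h2'
    subst this
    exact Subtype.ext (h1.symm.trans h1')
  let g : Q → Q → ℚ := fun c d =>
    if ∃ v, σ.D.connectedComponentMk v = d.1 ∧ (σ.K (u c)).Reachable (u c) v then 1 else 0
  have hg : ∀ c x (hx : σ.U x), g c ⟨σ.D.connectedComponentMk x, hU hx⟩ =
      if (σ.K (u c)).Reachable (u c) x then 1 else 0 := by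
    intro c x hx
    simp only [g]
    congr 1
    refine propext ⟨?_, fun h => ⟨x, rfl, h⟩⟩
    rintro ⟨v, h1, h2⟩
    exact h2.trans ((ConnectedComponent.exact h1).mono (σ.D_le_K _))
  refine lin_contra (fun c => ⟨σ.D.connectedComponentMk (u c), hU (hUu c)⟩)
    (fun c => ⟨σ.D.connectedComponentMk (w c), hU (hUw c)⟩) g ?_
  intro c c'
  rw [hg c _ (hUu c'), hg c _ (hUw c')]
  by_cases hcc : c = c'
  · subst hcc
    rw [if_pos (Reachable.refl _), if_neg (fun h => hne c (σ.region_sep (hFr c) h)), if_pos rfl]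
    norm_num
  · rw [if_neg hcc]
    by_cases hr : σ.F.Reachable (u c) (u c')
    · rw [if_neg, if_neg]
      · norm_num
      · intro h
        have e := σ.region_sep (hr.trans (hFr c')) h
        exact hcc (hdis (hu c) (e ▸ hw c'))
      · intro h
        have e := σ.region_sep hr h
        exact hcc (hdis (hu c) (e ▸ hu c'))
    · have h1 := σ.F_K (hFr c') hr
      have : (σ.K (u c)).Reachable (u c) (u c') ↔ (σ.K (u c)).Reachable (u c) (w c') :=
        ⟨fun h => h.trans h1, fun h => h.trans h1.symm⟩
      simp [this]

end Su

theorem PC.insert {V : Type} {r : V → V → Prop} {Q : Set V} (h : PC r Q) {x y : V} (hx : x ∈ Q)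
    (hxy : r x y) (hyx : r y x) : PC r (insert y Q) := by
  rintro Y ⟨z, hz, hzY⟩ hc
  have hxQ : x ∈ Insert.insert y Q := Or.inr hx
  have hyQ : y ∈ Insert.insert y Q := Or.inl rfl
  have hsub : (∃ q ∈ Q, q ∈ Y) → Q ⊆ Y := fun hq =>
    h Y hq fun a ha b hb => hc a (Or.inr ha) b (Or.inr hb)
  have hQ : Q ⊆ Y := by
    rcases hz with rfl | hz
    · exact hsub ⟨x, hx, hc _ hyQ _ hxQ hzY hyx⟩
    · exact hsub ⟨z, hz, hzY⟩
  rintro a (rfl | ha)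
  · exact hc _ hxQ _ hyQ (hQ hx) hxy
  · exact hQ ha

namespace Su
variable {VH : Type} {H : SimpleGraph VH} (σ : Su H)

theorem free_copy [Finite VH] (X : Set (Sym2 σ.GV)) (hXG : X ⊆ σ.G.edgeSet)
    (hX : X.ncard < σ.r) : ∃ t : Fin σ.r, ∀ e ∈ X, ∀ v, σ.cp v t ∉ e := by
  by_contra hc
  push Not at hc
  choose e he v hv using hc
  have hinj : Function.Injective e := by
    intro t t' h
    by_contra htt
    have h1 := hv t
    have h2 := hv t'
    rw [← h] at h2
    have hne : σ.cp (v t) t ≠ σ.cp (v t') t' := by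
      intro h
      simp [cp] at h
      exact htt h.2
    have h3 := (Sym2.mem_and_mem_iff hne).1 ⟨h1, h2⟩
    have h4 := hXG (he t)
    rw [h3, mem_edgeSet] at h4
    rcases σ.G_cp h4 with ⟨b, -, h5⟩ | ⟨-, h5⟩
    · simp [cp] at h5
      exact htt h5.2.symm
    · simp at h5
  have h1 : (Set.range e).ncard ≤ X.ncard :=
    Set.ncard_le_ncard (by rintro _ ⟨t, rfl⟩; exact he t) (Set.toFinite _)
  rw [← Set.image_univ, Set.ncard_image_of_injective _ hinj, Set.ncard_univ, Nat.card_fin] at h1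
  omega

theorem robust [Finite VH] (hrob : ∀ i (X : Set (Sym2 (σ.W i))), X ⊆ (σ.As i).edgeSet →
      X.ncard < σ.r → ∃ B : (σ.S i).verts → Set (σ.W i),
        IsModel (σ.S i).coe ((σ.As i).deleteEdges X) B ∧
        ∀ s : {s : VH // s ∈ (σ.S i).verts ∧ IsCutvertex H s}, σ.s' i s ∈ B ⟨s.1, s.2.1⟩)
    (X : Set (Sym2 σ.GV)) (hXG : X ⊆ σ.G.edgeSet) (hX : X.ncard < σ.r) :
    IsMinor H (σ.G.deleteEdges X) := by
  obtain ⟨t, ht⟩ := σ.free_copy X hXG hX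
  have hB : ∀ i, ∃ B : (σ.S i).verts → Set (σ.W i),
      IsModel (σ.S i).coe ((σ.As i).deleteEdges {e | e ∈ (σ.As i).edgeSet ∧ Sym2.map (σ.φ i) e ∈ X}) B ∧
        ∀ s : {s : VH // s ∈ (σ.S i).verts ∧ IsCutvertex H s}, σ.s' i s ∈ B ⟨s.1, s.2.1⟩ := by
    intro i
    refine hrob i _ (fun e he => he.1) (lt_of_le_of_lt ?_ hX)
    exact Set.ncard_le_ncard_of_injOn (Sym2.map (σ.φ i)) (fun e he => he.2)
      ((Sym2.map.injective (σ.φ_inj i)).injOn) (Set.toFinite _)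
  choose B hBm hBs using hB
  have hBm' := fun i => (isModel_iff _ _ _).1 (hBm i)
  have hφ : ∀ i a b, ((σ.As i).deleteEdges {e | e ∈ (σ.As i).edgeSet ∧ Sym2.map (σ.φ i) e ∈ X}).Adj a b →
      (σ.G.deleteEdges X).Adj (σ.φ i a) (σ.φ i b) := by
    intro i a b hab
    rw [deleteEdges_adj] at hab ⊢
    exact ⟨Or.inl ⟨i, a, b, hab.1, rfl, rfl⟩, fun h => hab.2 ⟨hab.1, h⟩⟩
  have hcp : ∀ v y, σ.G.Adj (σ.cp v t) y → (σ.G.deleteEdges X).Adj (σ.cp v t) y := by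
    intro v y h
    rw [deleteEdges_adj]
    exact ⟨h, fun h' => ht _ h' v (Sym2.mem_mk_left _ _)⟩
  refine ⟨fun v => {x | (∃ i, ∃ hv : v ∈ (σ.S i).verts, ∃ w ∈ B i ⟨v, hv⟩, x = σ.φ i w) ∨
    ((∀ i, v ∈ (σ.S i).verts → IsCutvertex H v) ∧ x = σ.cp v t)}, ?_⟩
  rw [isModel_iff]
  refine ⟨?_, ?_, ?_, ?_⟩
  · intro v
    by_cases h : ∀ i, v ∈ (σ.S i).verts → IsCutvertex H v
    · exact ⟨_, Or.inr ⟨h, rfl⟩⟩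
    · push Not at h
      obtain ⟨i, hv, -⟩ := h
      obtain ⟨w, hw⟩ := (hBm' i).1 ⟨v, hv⟩
      exact ⟨_, Or.inl ⟨i, hv, w, hw, rfl⟩⟩
  · intro v
    have hpc : ∀ i (hv : v ∈ (σ.S i).verts), PC (σ.G.deleteEdges X).Adj (σ.φ i '' B i ⟨v, hv⟩) :=
      fun i hv => ((hBm' i).2.1 ⟨v, hv⟩).image _ (fun a _ b _ h => hφ i a b h)
    by_cases h : ∀ i, v ∈ (σ.S i).verts → IsCutvertex H v
    · refine PC.of_core (S := {σ.cp v t}) (PC.singleton _) ?_ ?_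
      · rintro _ rfl
        exact Or.inr ⟨h, rfl⟩
      · rintro a (⟨i, hv, w, hw, rfl⟩ | ⟨-, rfl⟩)
        · have hc := h i hv
          have hs : σ.tm v ∈ σ.φ i '' B i ⟨v, hv⟩ := ⟨_, hBs i ⟨v, hv, hc⟩, σ.φ_s' i _⟩
          have hadj : (σ.G.deleteEdges X).Adj (σ.cp v t) (σ.tm v) :=
            hcp v _ (Or.inr (Or.inr ⟨v, t, ⟨i, hv, hc⟩, Or.inr ⟨rfl, rfl⟩⟩))
          refine ⟨insert (σ.cp v t) (σ.φ i '' B i ⟨v, hv⟩), ?_, Or.inr ⟨w, hw, rfl⟩,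
            (hpc i hv).insert hs hadj.symm hadj, σ.cp v t, Or.inl rfl, rfl⟩
          rintro x (rfl | ⟨w', hw', rfl⟩)
          · exact Or.inr ⟨h, rfl⟩
          · exact Or.inl ⟨i, hv, w', hw', rfl⟩
        · refine ⟨{σ.cp v t}, ?_, rfl, PC.singleton _, _, rfl, rfl⟩
          rintro _ rfl
          exact Or.inr ⟨h, rfl⟩
    · have h' := h
      push Not at h'
      obtain ⟨i, hv, hnc⟩ := h'
      convert hpc i hv using 1
      ext x
      constructor
      · rintro (⟨j, hv', w, hw, rfl⟩ | ⟨h', -⟩)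
        · by_cases hij : i = j
          · subst hij
            exact ⟨w, hw, rfl⟩
          · exact (hnc (block_cut2 (σ.hS i) (σ.hS j) (σ.nt i) (σ.nt j)
              (fun e => hij (σ.hinj e)) hv hv')).elim
        · exact (h h').elim
      · rintro ⟨w, hw, rfl⟩
        exact Or.inl ⟨i, hv, w, hw, rfl⟩
  · rintro u v x (⟨i, hu, w, hw, rfl⟩ | ⟨hu, rfl⟩) (⟨j, hv, w', hw', h⟩ | ⟨hv, h⟩)
    · rcases σ.φ_eq h with ⟨e, h'⟩ | ⟨s, s2, hst, rfl, rfl⟩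
      · subst e
        simp only at h'
        subst h'
        exact congrArg Subtype.val ((hBm' i).2.2.1 _ _ _ hw hw')
      · have e1 := congrArg Subtype.val ((hBm' i).2.2.1 _ _ _ hw (hBs i s))
        have e2 := congrArg Subtype.val ((hBm' j).2.2.1 _ _ _ hw' (hBs j s2))
        exact e1.trans (hst.trans e2.symm)
    · exact (σ.φ_cp h).elim
    · exact (σ.φ_cp h.symm).elim
    · simp [cp] at h
      exact h
  · intro u v huv
    by_cases hD : σ.D.Adj u v
    · obtain ⟨i, hi⟩ := hD
      obtain ⟨a, ha, b, hb, hab⟩ := (hBm' i).2.2.2 ⟨u, hi.fst_mem⟩ ⟨v, hi.snd_mem⟩ hi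
      exact ⟨_, Or.inl ⟨i, _, a, ha, rfl⟩, _, Or.inl ⟨i, _, b, hb, rfl⟩, hφ i a b hab⟩
    · refine ⟨σ.cp u t, Or.inr ⟨?_, rfl⟩, σ.cp v t, Or.inr ⟨?_, rfl⟩,
        hcp _ _ (Or.inr (Or.inl ⟨t, u, v, ⟨huv, hD⟩, rfl, rfl⟩))⟩
      · intro i hu
        exact block_cut (σ.hS i) (σ.nt i) hu huv (fun h => hD ⟨i, h⟩)
      · intro i hv
        exact block_cut (σ.hS i) (σ.nt i) hv huv.symm (fun h => hD ⟨i, h.symm⟩)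

end Su

theorem pigeon {ι : Type} [Fintype ι] (k : ι → ℕ) (j : Fin (∑ i, k i + 1) → ι) :
    ∃ i, ∃ f : Fin (k i) → Fin (∑ i, k i + 1), Function.Injective f ∧ ∀ x, j (f x) = i := by
  classical
  have : ∃ i, k i ≤ (Finset.univ.filter fun l => j l = i).card := by
    by_contra hc
    push Not at hc
    have h1 := Finset.card_eq_sum_card_fiberwise (f := j) (s := Finset.univ) (t := Finset.univ)
      (fun _ _ => Finset.mem_coe.2 (Finset.mem_univ _))
    have h2 : ∑ i, (Finset.univ.filter fun l => j l = i).card ≤ ∑ i, k i :=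
      Finset.sum_le_sum fun i _ => (hc i).le
    rw [← h1, Finset.card_univ, Fintype.card_fin] at h2
    omega
  obtain ⟨i, hi⟩ := this
  obtain ⟨T, hT, hTc⟩ := Finset.exists_subset_card_eq hi
  let e := (Finset.equivFinOfCardEq hTc).symm
  refine ⟨i, fun x => (e x).1, fun a b h => e.injective (Subtype.ext h), fun x => ?_⟩
  exact (Finset.mem_filter.1 (hT (e x).2)).2

theorem no_F {P : ∀ ⦃V : Type⦄, SimpleGraph V → Prop}
    (hered : ∀ {V W : Type} (G : SimpleGraph V) (M : SimpleGraph W),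
      ¬ P G → IsMinor M G → ¬ P M)
    {VH : Type} [Finite VH] {H : SimpleGraph VH} (A : H.Subgraph) (hA : IsBlock H A)
    (hPA : P A.coe) (hnt : A.verts.Nontrivial) (F : SimpleGraph VH) (hFH : F ≤ H)
    (hF : ∀ B : H.Subgraph, IsBlock H B → P B.coe → IsMinor A.coe B.coe → ∀ a b, B.Adj a b →
      ¬ F.Adj a b) : ¬ IsMinor A.coe F := by
  rintro ⟨ν, hν⟩
  obtain ⟨ν', hν', -, hZ⟩ := min_model hA.1 hA.2.1 hν
  have hm := (isModel_iff _ _ _).1 hν'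
  let C : H.Subgraph :=
    { verts := ⋃ u, ν' u
      Adj := fun a b => F.Adj a b ∧ a ∈ ⋃ u, ν' u ∧ b ∈ ⋃ u, ν' u
      adj_sub := fun h => hFH h.1
      edge_vert := fun h => h.2.1
      symm := ⟨fun _ _ h => ⟨h.1.symm, h.2.2, h.2.1⟩⟩ }
  have hC : TC C.Adj C.verts :=
    ⟨hZ.1, hZ.2.1.mono fun a ha b hb h => ⟨h, ha, hb⟩,
      fun x => (hZ.2.2 x).mono fun a ha b hb h => ⟨h, ha.1, hb.1⟩⟩
  obtain ⟨B, hB, hCB⟩ := exists_block hC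
  have hAB : IsMinor A.coe B.coe := by
    refine ⟨_, hν'.pull (Subtype.val : B.verts → VH) Subtype.val_injective ?_ ?_⟩
    · intro u z hz
      exact ⟨⟨z, hCB.1 (Set.mem_iUnion.2 ⟨u, hz⟩)⟩, rfl⟩
    · intro a b ha hb hab
      exact hCB.2 ⟨hab, Set.mem_iUnion.2 ha, Set.mem_iUnion.2 hb⟩
  have hPB : P B.coe := by
    by_contra h
    exact hered _ _ h hAB hPA
  obtain ⟨x, hx, y, hy, hxy⟩ := hnt
  obtain ⟨a, ha⟩ := hm.1 ⟨x, hx⟩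
  obtain ⟨b, hb⟩ := hm.1 ⟨y, hy⟩
  have hab : b ≠ a := by
    rintro rfl
    exact hxy (congrArg Subtype.val (hm.2.2.1 _ _ _ ha hb))
  obtain ⟨p, hp, -, q, hq, -, hpq⟩ := hZ.2.1.cross {a} (Set.mem_iUnion.2 ⟨_, ha⟩) rfl
    (Set.mem_iUnion.2 ⟨_, hb⟩) hab
  exact hF B hB hPB hAB p q (hCB.2 ⟨hpq, hp, hq⟩) hpq

theorem exists_max_rel {T : Type} [Finite T] [Nonempty T] (R : T → T → Prop) (h1 : ∀ a, R a a)
    (h2 : ∀ a b c, R a b → R b c → R a c) : ∃ a, ∀ b, R a b → R b a := by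
  let _ : Preorder T := { le := R, le_refl := h1, le_trans := h2 }
  obtain ⟨A, hA⟩ := (Set.toFinite (Set.univ : Set T)).exists_maximal Set.univ_nonempty
  exact ⟨A, fun b hb => hA.le_of_ge trivial hb⟩

/-- Let `𝓟` be a hereditary graph property and `H` a graph with a block
having property `𝓟`, such that every block of `H` with property `𝓟` admits a generic
counterexample. Then `𝓕_H` does not have the edge-Erdős–Pósa property. -/
theorem not_edgeEP_of_blocks (P : ∀ ⦃V : Type⦄, SimpleGraph V → Prop)
    (hered : ∀ {V W : Type} (G : SimpleGraph V) (M : SimpleGraph W),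
      ¬ P G → IsMinor M G → ¬ P M)
    {VH : Type} [Fintype VH] (H : SimpleGraph VH)
    (hblock : ∃ A : H.Subgraph, IsBlock H A ∧ P A.coe)
    (hgen : ∀ A : H.Subgraph, IsBlock H A → P A.coe → GenericCounterexample H A) :
    ¬ EdgeEP H := by
  classical
  rintro ⟨f, hf⟩
  obtain ⟨A, hA, hPA, hmax⟩ : ∃ A : H.Subgraph, IsBlock H A ∧ P A.coe ∧
      ∀ B : H.Subgraph, IsBlock H B → P B.coe → IsMinor A.coe B.coe → IsMinor B.coe A.coe := by
    let T := {A : H.Subgraph // IsBlock H A ∧ P A.coe}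
    have : Nonempty T := by
      obtain ⟨A0, hA0⟩ := hblock
      exact ⟨⟨A0, hA0⟩⟩
    obtain ⟨A, hA⟩ := exists_max_rel (fun a b : T => IsMinor a.1.coe b.1.coe)
      (fun a => IsMinor.refl' _) (fun a b c h1 h2 => IsMinor.trans' h1 h2)
    exact ⟨A.1, A.2.1, A.2.2, fun B h1 h2 h3 => hA ⟨B, h1, h2⟩ h3⟩
  let ι := {B : H.Subgraph // IsBlock H B ∧ P B.coe ∧ IsMinor A.coe B.coe}
  have hfι : Finite ι := inferInstance
  have : Fintype ι := Fintype.ofFinite ι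
  have hg : ∀ i : ι, GenericCounterexample H i.1 := fun i => hgen i.1 i.2.1 i.2.2.1
  have hbig : ∀ (i : ι) a b, ∃ c ∈ i.1.verts, c ≠ a ∧ c ≠ b := fun i a b =>
    generic_big ((isBlock_iff _).1 i.2.1).1 (hg i) a b
  choose k hk using hg
  choose W fW As s' hnk hrob using fun i => hk i (⌊f (∑ i, k i + 1)⌋₊ + 1)
  let σ : Su H :=
    { ι := ι
      fι := hfι
      S := fun i => i.1
      hS := fun i => i.2.1
      hinj := Subtype.val_injective
      hbig := hbig
      W := W
      fW := fun i => @Finite.of_fintype _ (fW i)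
      As := As
      s' := s'
      s'_inj := by
        intro i s t hst
        obtain ⟨B, hB, hs⟩ := hrob i ∅ (Set.empty_subset _) (by simp)
        have h1 := hs s
        rw [hst] at h1
        have h2 := ((isModel_iff _ _ _).1 hB).2.2.1 _ _ _ h1 (hs t)
        exact Subtype.ext (Subtype.mk.inj h2)
      r := ⌊f (∑ i, k i + 1)⌋₊ + 1 }
  have hneι : Nonempty σ.ι := ⟨⟨A, hA, hPA, IsMinor.refl' _⟩⟩
  have hntA : A.verts.Nontrivial := σ.nt ⟨A, hA, hPA, IsMinor.refl' _⟩
  have hFA : ¬ IsMinor A.coe σ.F :=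
    no_F hered A hA hPA hntA σ.F (fun _ _ h => h.1)
      (fun B h1 h2 h3 a b hab h => h.2 ⟨⟨B, h1, h2, h3⟩, hab⟩)
  have hF : ∀ i, ¬ IsMinor (σ.S i).coe σ.F := fun i h => hFA (IsMinor.trans' i.2.2.2 h)
  rcases hf σ.GV (Fintype.ofFinite _) σ.G (∑ i, k i + 1) with h | ⟨X, hX, hc, hno⟩
  · obtain ⟨N, hNG, hNd, hNH⟩ := (edgeDisj_iff _ _ _).1 h
    have hij : ∀ l, ∃ j : σ.ι, IsMinor (σ.S j).coe ((N l).comap (σ.φ j)) := by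
      intro l
      obtain ⟨μ, hμ⟩ := hNH l
      obtain ⟨i, j, hm⟩ := σ.count (hNG l) hμ hF
      have h1 : IsMinor j.1.coe A.coe := hmax j.1 j.2.1 j.2.2.1 j.2.2.2
      exact ⟨j, IsMinor.trans' (IsMinor.trans' h1 i.2.2.2) hm⟩
    choose j hj using hij
    obtain ⟨i, g, hginj, hgj⟩ := pigeon k j
    refine hnk i ((edgeDisj_iff _ _ _).2 ⟨fun x => (N (g x)).comap (σ.φ i), ?_, ?_, ?_⟩)
    · intro x a b hab
      exact σ.G_φ (hNG _ hab)
    · intro x y hxy a b h1 h2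
      exact hNd _ _ (fun e => hxy (hginj e)) _ _ h1 h2
    · intro x
      have := hj (g x)
      rw [hgj x] at this
      exact this
  · refine hno (σ.robust hrob X hX ?_)
    have : X.ncard ≤ ⌊f (∑ i, k i + 1)⌋₊ := Nat.le_floor hc
    exact Nat.lt_succ_of_le this
end
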